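/- arXiv:2409.09465 — 2 statements merged into one kernel-verified Lean document; each statement's English description precedes it below -/
import Mathlib

section
/- Every 3-connected braced polygon graph P with at least 4 vertices can be constructed from K₄ (as a braced quadrilateral) by a sequence of the following operations, each preserving 3-connectivity: (1) subdivide a boundary edge (i,j) by a new vertex k and join k to one additional existing vertex; (2) subdivide two boundary edges (i₁,j₁) and (i₂,j₂) by new vertices k₁ and k₂ respectively and add the brace (k₁,k₂); (3) add a brace between two existing vertices. Moreover, if P is minimally 3-connected, only operations (1) and (2) are needed. -/
/-- A boundary edge of the `n`-gon: an edge of the form `{i, i+1}`. -/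
def IsBoundaryEdge (n : ℕ) (e : Sym2 (ZMod n)) : Prop := ∃ i : ZMod n, e = s(i, i + 1)

/-- The braced polygon graph on the cyclically ordered vertex set `ZMod n`:
the boundary Hamilton cycle `{i, i+1}` together with the set `B` of braces. -/
def bpGraph (n : ℕ) (B : Finset (Sym2 (ZMod n))) : SimpleGraph (ZMod n) :=
  SimpleGraph.fromEdgeSet ((↑B : Set (Sym2 (ZMod n))) ∪ {e | IsBoundaryEdge n e})

/-- A graph is 3-connected if it has at least 4 vertices and deleting any
at most 2 vertices leaves it connected. -/
def ThreeConnected {V : Type*} [Fintype V] (G : SimpleGraph V) : Prop :=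
  4 ≤ Fintype.card V ∧
    ∀ s : Finset V, s.card ≤ 2 → (G.induce ((↑s : Set V)ᶜ)).Connected

/-- A braced polygon graph is minimally 3-connected if it is 3-connected and
deleting any brace destroys 3-connectivity. -/
def MinThreeConnectedBP (n : ℕ) [NeZero n] (B : Finset (Sym2 (ZMod n))) : Prop :=
  ThreeConnected (bpGraph n B) ∧ ∀ e ∈ B, ¬ ThreeConnected (bpGraph n (B.erase e))

/-- The relabelling of the vertices of the `n`-gon into the `(n+1)`-gon obtained by
inserting a new vertex (labelled `a+1`) on the boundary edge `{a, a+1}`: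
labels `≤ a` are kept, larger labels are shifted by one. -/
def vmap1 (n : ℕ) (a : ZMod n) (j : ZMod n) : ZMod (n + 1) :=
  if j.val ≤ a.val then (j.val : ZMod (n + 1)) else ((j.val + 1 : ℕ) : ZMod (n + 1))

/-- The relabelling of the vertices of the `n`-gon into the `(n+2)`-gon obtained by
inserting new vertices on the boundary edges `{a, a+1}` and `{b, b+1}`
(where `a.val < b.val`); the new vertices get labels `a+1` and `b+2`. -/
def vmap2 (n : ℕ) (a b : ZMod n) (j : ZMod n) : ZMod (n + 2) :=
  if j.val ≤ a.val then (j.val : ZMod (n + 2))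
  else if j.val ≤ b.val then ((j.val + 1 : ℕ) : ZMod (n + 2))
  else ((j.val + 2 : ℕ) : ZMod (n + 2))

/-- Operation (1): subdivide the boundary edge `{a, a+1}` by a new vertex and join the
new vertex to the (old) vertex `u`. -/
def op1Braces (n : ℕ) (a u : ZMod n) (B : Finset (Sym2 (ZMod n))) :
    Finset (Sym2 (ZMod (n + 1))) :=
  insert s(((a.val + 1 : ℕ) : ZMod (n + 1)), vmap1 n a u)
    (B.image (Sym2.map (vmap1 n a)))

/-- Operation (2): subdivide the two boundary edges `{a, a+1}` and `{b, b+1}` by new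
vertices `k₁`, `k₂` and add the brace `{k₁, k₂}`. -/
def op2Braces (n : ℕ) (a b : ZMod n) (B : Finset (Sym2 (ZMod n))) :
    Finset (Sym2 (ZMod (n + 2))) :=
  insert s(((a.val + 1 : ℕ) : ZMod (n + 2)), ((b.val + 2 : ℕ) : ZMod (n + 2)))
    (B.image (Sym2.map (vmap2 n a b)))

/-- Constructibility of a braced polygon graph (given by the brace set `B` on the
cyclic vertex set `ZMod n`) from `K₄` (the square with both diagonals) by the three
operations, each step producing a 3-connected braced polygon graph.  When
`allow3 = false`, only operations (1) and (2) may be used. -/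
inductive BPConstructible (allow3 : Bool) : (n : ℕ) → Finset (Sym2 (ZMod n)) → Prop
  | base : BPConstructible allow3 4 {s((0 : ZMod 4), 2), s((1 : ZMod 4), 3)}
  | op1 {n : ℕ} {B : Finset (Sym2 (ZMod n))} (a u : ZMod n)
      (hprev : BPConstructible allow3 n B)
      (hchord : ¬ (s(((a.val + 1 : ℕ) : ZMod (n + 1)), vmap1 n a u)).IsDiag ∧
        ¬ IsBoundaryEdge (n + 1) s(((a.val + 1 : ℕ) : ZMod (n + 1)), vmap1 n a u))
      (hconn : ThreeConnected (bpGraph (n + 1) (op1Braces n a u B))) :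
      BPConstructible allow3 (n + 1) (op1Braces n a u B)
  | op2 {n : ℕ} {B : Finset (Sym2 (ZMod n))} (a b : ZMod n) (hab : a.val < b.val)
      (hprev : BPConstructible allow3 n B)
      (hconn : ThreeConnected (bpGraph (n + 2) (op2Braces n a b B))) :
      BPConstructible allow3 (n + 2) (op2Braces n a b B)
  | op3 {n : ℕ} [NeZero n] {B : Finset (Sym2 (ZMod n))} (c : Sym2 (ZMod n))
      (h3 : allow3 = true)
      (hc : ¬ c.IsDiag ∧ ¬ IsBoundaryEdge n c ∧ c ∉ B)
      (hprev : BPConstructible allow3 n B)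
      (hconn : ThreeConnected (bpGraph n (insert c B))) :
      BPConstructible allow3 n (insert c B)

/-- Every pair `s < t` of non-consecutive labels on the `n`-gon is crossed by a brace:
the brace has one end strictly between `s` and `t` and its other end strictly outside. -/
def CrossesDiagonals (n : ℕ) (B : Finset (Sym2 (ZMod n))) : Prop :=
  ∀ s t : ℕ, s + 1 < t → t < n → (s ≠ 0 ∨ t + 1 ≠ n) →
    ∃ x y : ZMod n, s(x, y) ∈ B ∧ s < x.val ∧ x.val < t ∧ (y.val < s ∨ t < y.val)

theorem CrossesDiagonals.mono {n : ℕ} {B B' : Finset (Sym2 (ZMod n))}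
    (h : CrossesDiagonals n B) (hBB' : B ⊆ B') : CrossesDiagonals n B' := by
  intro s t h1 h2 h3
  obtain ⟨x, y, hxy, h⟩ := h s t h1 h2 h3
  exact ⟨x, y, hBB' hxy, h⟩

theorem zmod_val_add_one {n : ℕ} [NeZero n] (hn : 2 ≤ n) (i : ZMod n) :
    (i + 1).val = if i.val + 1 = n then 0 else i.val + 1 := by
  have hi := ZMod.val_lt i
  have : Fact (1 < n) := ⟨hn⟩
  rw [ZMod.val_add, ZMod.val_one]
  split_ifs with h
  · rw [h, Nat.mod_self]
  · exact Nat.mod_eq_of_lt (by omega)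

theorem IsBoundaryEdge.val_cases {n : ℕ} [NeZero n] (hn : 2 ≤ n) {x y : ZMod n}
    (h : IsBoundaryEdge n s(x, y)) :
    y.val = x.val + 1 ∨ x.val = y.val + 1 ∨ (x.val = 0 ∧ y.val + 1 = n) ∨
      (y.val = 0 ∧ x.val + 1 = n) := by
  obtain ⟨i, hi⟩ := h
  have hv := zmod_val_add_one hn i
  rcases Sym2.eq_iff.1 hi with ⟨rfl, rfl⟩ | ⟨rfl, rfl⟩ <;> split_ifs at hv <;> omega

theorem bpGraph_adj_iff {n : ℕ} {B : Finset (Sym2 (ZMod n))} {x y : ZMod n} :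
    (bpGraph n B).Adj x y ↔ (s(x, y) ∈ B ∨ IsBoundaryEdge n s(x, y)) ∧ x ≠ y := by
  simp [bpGraph, or_and_right]

theorem ThreeConnected.crossesDiagonals {n : ℕ} [NeZero n] {B : Finset (Sym2 (ZMod n))}
    (h : ThreeConnected (bpGraph n B)) : CrossesDiagonals n B := by
  obtain ⟨h4, h⟩ := h
  rw [ZMod.card] at h4
  intro s t hst htn hne
  have hs : ((s : ℕ) : ZMod n).val = s := ZMod.val_cast_of_lt (by omega)
  have ht : ((t : ℕ) : ZMod n).val = t := ZMod.val_cast_of_lt (by omega)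
  by_contra! hno
  have hconn := h {(s : ZMod n), (t : ZMod n)} Finset.card_le_two
  have closed : ∀ u v, ((bpGraph n B).induce
      ((↑({(s : ZMod n), (t : ZMod n)} : Finset (ZMod n)) : Set (ZMod n))ᶜ)).Reachable u v →
      (s < u.1.val ∧ u.1.val < t) → (s < v.1.val ∧ v.1.val < t) := by
    rintro u v ⟨p⟩
    induction p with
    | nil => exact id
    | @cons u v w huv p ih =>
      intro hu
      apply ih
      have hv := v.2
      simp only [Finset.coe_insert, Finset.coe_singleton, Set.mem_compl_iff,
        Set.mem_insert_iff, Set.mem_singleton_iff, not_or] at hv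
      have hvs : v.1.val ≠ s := fun e => hv.1 (by
      rw [← ZMod.natCast_zmod_val v.1, e])
      have hvt : v.1.val ≠ t := fun e => hv.2 (by
      rw [← ZMod.natCast_zmod_val v.1, e])
      have hadj : (bpGraph n B).Adj u.1 v.1 := huv
      rcases (bpGraph_adj_iff.1 hadj).1 with hb | hb
      · have := hno u.1 v.1 hb hu.1 hu.2
        omega
      · have := hb.val_cases (by omega)
        omega
  have mem : ∀ k : ℕ, k < n → k ≠ s → k ≠ t → ((k : ℕ) : ZMod n) ∈
      ((↑({(s : ZMod n), (t : ZMod n)} : Finset (ZMod n)) : Set (ZMod n))ᶜ) := by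
    intro k hk hks hkt
    have hkv : ((k : ℕ) : ZMod n).val = k := ZMod.val_cast_of_lt hk
    simp only [Finset.coe_insert, Finset.coe_singleton, Set.mem_compl_iff,
      Set.mem_insert_iff, Set.mem_singleton_iff, not_or]
    exact ⟨fun e => hks (by rw [← hkv, e, hs]), fun e => hkt (by rw [← hkv, e, ht])⟩
  obtain ⟨k, hk, hkout⟩ : ∃ k, k < n ∧ (k < s ∨ t < k) := by
    rcases hne with h0 | h0
    · exact ⟨0, by omega, by omega⟩
    · exact ⟨n - 1, by omega, by omega⟩
  have hkv : ((k : ℕ) : ZMod n).val = k := ZMod.val_cast_of_lt hk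
  have hsv : ((s + 1 : ℕ) : ZMod n).val = s + 1 := ZMod.val_cast_of_lt (by omega)
  have := closed ⟨_, mem (s + 1) (by omega) (by omega) (by omega)⟩
    ⟨_, mem k hk (by omega) (by omega)⟩ (hconn.preconnected _ _)
  simp only [hsv, hkv] at this
  omega

/-- The vertices `u` and `v` avoid `S` and are joined by a path of `G` avoiding `S`. -/
def JoinedOff {V : Type*} (G : SimpleGraph V) (S : Finset V) (u v : V) : Prop :=
  ∃ (hu : u ∈ ((↑S : Set V)ᶜ)) (hv : v ∈ ((↑S : Set V)ᶜ)),
    (G.induce ((↑S : Set V)ᶜ)).Reachable ⟨u, hu⟩ ⟨v, hv⟩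

namespace JoinedOff

variable {V : Type*} {G : SimpleGraph V} {S : Finset V} {u v w : V}

theorem refl (hu : u ∉ S) : JoinedOff G S u u :=
  ⟨by simpa using hu, by simpa using hu, SimpleGraph.Reachable.refl _⟩

theorem symm (h : JoinedOff G S u v) : JoinedOff G S v u := by
  obtain ⟨hu, hv, h⟩ := h
  exact ⟨hv, hu, h.symm⟩

theorem trans (h : JoinedOff G S u v) (h' : JoinedOff G S v w) : JoinedOff G S u w := by
  obtain ⟨hu, hv, h⟩ := h
  obtain ⟨_, hw, h'⟩ := h'
  exact ⟨hu, hw, h.trans h'⟩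

theorem of_adj (h : G.Adj u v) (hu : u ∉ S) (hv : v ∉ S) : JoinedOff G S u v :=
  ⟨by simpa using hu, by simpa using hv,
    SimpleGraph.Adj.reachable (G := G.induce ((↑S : Set V)ᶜ)) h⟩

end JoinedOff

theorem bpGraph_adj_succ {n : ℕ} [NeZero n] (hn : 2 ≤ n) (B : Finset (Sym2 (ZMod n)))
    (i : ZMod n) : (bpGraph n B).Adj i (i + 1) := by
  refine bpGraph_adj_iff.2 ⟨Or.inr ⟨i, rfl⟩, fun e => ?_⟩
  have := congrArg ZMod.val e
  rw [zmod_val_add_one hn] at this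
  have := ZMod.val_lt i
  split_ifs at * <;> omega

theorem joinedOff_add {n : ℕ} [NeZero n] (hn : 2 ≤ n) (B : Finset (Sym2 (ZMod n)))
    (S : Finset (ZMod n)) (u d : ℕ)
    (h : ∀ w : ℕ, u ≤ w → w ≤ u + d → (w : ZMod n) ∉ S) :
    JoinedOff (bpGraph n B) S (u : ZMod n) ((u + d : ℕ) : ZMod n) := by
  induction d with
  | zero => exact JoinedOff.refl (h u le_rfl le_rfl)
  | succ d ih =>
    refine (ih fun w h1 h2 => h w h1 (by omega)).trans (JoinedOff.of_adj ?_
      (h _ (by omega) (by omega)) (h _ (by omega) (by omega)))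
    have := bpGraph_adj_succ hn B ((u + d : ℕ) : ZMod n)
    rwa [show ((u + d : ℕ) : ZMod n) + 1 = ((u + (d + 1) : ℕ) : ZMod n) by push_cast; ring]
      at this

theorem joinedOff_inner {n : ℕ} [NeZero n] (hn : 2 ≤ n) (B : Finset (Sym2 (ZMod n)))
    (S : Finset (ZMod n)) (u v : ZMod n)
    (h : ∀ w : ZMod n, (u.val ≤ w.val ∧ w.val ≤ v.val) ∨ (v.val ≤ w.val ∧ w.val ≤ u.val) →
      w ∉ S) :
    JoinedOff (bpGraph n B) S u v := by
  wlog huv : u.val ≤ v.val generalizing u v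
  · exact (this v u (fun w hw => h w hw.symm) (by omega)).symm
  have hv := ZMod.val_lt v
  have := joinedOff_add hn B S u.val (v.val - u.val) fun w h1 h2 => by
    have hw : ((w : ℕ) : ZMod n).val = w := ZMod.val_cast_of_lt (by omega)
    exact h _ (Or.inl (by omega))
  rwa [show u.val + (v.val - u.val) = v.val by omega, ZMod.natCast_zmod_val,
    ZMod.natCast_zmod_val] at this

theorem joinedOff_outer {n : ℕ} [NeZero n] (hn : 2 ≤ n) (B : Finset (Sym2 (ZMod n)))
    (S : Finset (ZMod n)) (u v : ZMod n)
    (h : ∀ w : ZMod n, w.val ≤ u.val ∨ v.val ≤ w.val → w ∉ S) :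
    JoinedOff (bpGraph n B) S u v := by
  have h0 : (0 : ZMod n).val = 0 := ZMod.val_zero
  have hl : ((n - 1 : ℕ) : ZMod n).val = n - 1 := ZMod.val_cast_of_lt (by omega)
  have hv := ZMod.val_lt v
  have h1 := joinedOff_inner hn B S u 0 fun w hw => h w (by omega)
  have h2 := joinedOff_inner hn B S ((n - 1 : ℕ) : ZMod n) v fun w hw => h w (by
    have := ZMod.val_lt w
    omega)
  have hadj := bpGraph_adj_succ hn B ((n - 1 : ℕ) : ZMod n)
  rw [show ((n - 1 : ℕ) : ZMod n) + 1 = 0 by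
    rw [← Nat.cast_succ, show (n - 1).succ = n by omega, ZMod.natCast_self]] at hadj
  exact h1.trans ((JoinedOff.of_adj hadj (h _ (by omega)) (h _ (by omega))).symm.trans h2)

theorem CrossesDiagonals.threeConnected {n : ℕ} [NeZero n] (hn : 4 ≤ n)
    {B : Finset (Sym2 (ZMod n))} (h : CrossesDiagonals n B) :
    ThreeConnected (bpGraph n B) := by
  refine ⟨by rwa [ZMod.card], fun S hS => ?_⟩
  have key : ∀ x y : ZMod n, x.val ≤ y.val → x ∉ S → y ∉ S →
      JoinedOff (bpGraph n B) S x y := by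
    intro x y hxy hx hy
    by_cases hin : ∀ w : ZMod n, x.val ≤ w.val → w.val ≤ y.val → w ∉ S
    · exact joinedOff_inner (by omega) B S x y fun w hw => hin w (by omega) (by omega)
    by_cases hout : ∀ w : ZMod n, w.val ≤ x.val ∨ y.val ≤ w.val → w ∉ S
    · exact joinedOff_outer (by omega) B S x y hout
    push Not at hin hout
    obtain ⟨p, hp1, hp2, hp⟩ := hin
    obtain ⟨q, hq1, hq⟩ := hout
    have neval : ∀ {a b : ZMod n}, a ∉ S → b ∈ S → a.val ≠ b.val := fun ha hb e =>
      ha (ZMod.val_injective n e ▸ hb)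
    have hxp := neval hx hp
    have hyp := neval hy hp
    have hxq := neval hx hq
    have hyq := neval hy hq
    have hpq : p ≠ q := by
      rintro rfl
      omega
    have hSeq : ∀ w ∈ S, w = p ∨ w = q := by
      intro w hw
      by_contra! hne
      have : ({w, p, q} : Finset (ZMod n)) ⊆ S := by
        intro z hz
        simp only [Finset.mem_insert, Finset.mem_singleton] at hz
        rcases hz with rfl | rfl | rfl <;> assumption
      have := Finset.card_le_card this
      rw [Finset.card_eq_three.2 ⟨w, p, q, hne.1, hne.2, hpq, rfl⟩] at this
      omega
    have hnot : ∀ w : ZMod n, w.val ≠ p.val → w.val ≠ q.val → w ∉ S := by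
      intro w h1 h2 hw
      rcases hSeq w hw with rfl | rfl <;> contradiction
    have hyn := ZMod.val_lt y
    have hpn := ZMod.val_lt p
    have hqn := ZMod.val_lt q
    -- `p` lies between `x` and `y`, and `q` lies outside
    rcases hq1 with hq1 | hq1
    · obtain ⟨c, d, hcd, hc1, hc2, hd⟩ := h q.val p.val (by omega) hpn (by omega)
      have hcS := hnot c (by omega) (by omega)
      have hdS := hnot d (by omega) (by omega)
      have hcd' : JoinedOff (bpGraph n B) S c d :=
        JoinedOff.of_adj (bpGraph_adj_iff.2 ⟨Or.inl hcd, by rintro rfl; omega⟩) hcS hdS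
      refine (joinedOff_inner (by omega) B S x c fun w hw =>
        hnot w (by omega) (by omega)).trans (hcd'.trans ?_)
      rcases hd with hd | hd
      · exact joinedOff_outer (by omega) B S d y fun w hw =>
          hnot w (by omega) (by omega)
      · exact joinedOff_inner (by omega) B S d y fun w hw => hnot w (by omega) (by omega)
    · obtain ⟨c, d, hcd, hc1, hc2, hd⟩ := h p.val q.val (by omega) hqn (by omega)
      have hcS := hnot c (by omega) (by omega)
      have hdS := hnot d (by omega) (by omega)
      have hcd' : JoinedOff (bpGraph n B) S c d :=
        JoinedOff.of_adj (bpGraph_adj_iff.2 ⟨Or.inl hcd, by rintro rfl; omega⟩) hcS hdS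
      refine JoinedOff.symm ((joinedOff_inner (by omega) B S y c fun w hw =>
        hnot w (by omega) (by omega)).trans (hcd'.trans ?_))
      rcases hd with hd | hd
      · exact joinedOff_inner (by omega) B S d x fun w hw => hnot w (by omega) (by omega)
      · exact (joinedOff_outer (by omega) B S x d fun w hw =>
          hnot w (by omega) (by omega)).symm
  have : Nonempty ↥((↑S : Set (ZMod n))ᶜ) := by
    obtain ⟨w, hw⟩ : ∃ w, w ∉ S := by
      by_contra! hall
      have := Finset.card_le_card (fun w _ => hall w : (Finset.univ : Finset (ZMod n)) ⊆ S)
      rw [Finset.card_univ, ZMod.card] at this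
      omega
    exact ⟨w, by simpa using hw⟩
  refine SimpleGraph.Connected.mk fun u v => ?_
  have hu : u.1 ∉ S := fun h => u.2 h
  have hv : v.1 ∉ S := fun h => v.2 h
  rcases le_total u.1.val v.1.val with huv | huv
  · exact (key _ _ huv hu hv).2.2
  · exact (key _ _ huv hv hu).2.2.symm

theorem val_vmap1 {n : ℕ} [NeZero n] (a j : ZMod n) :
    (vmap1 n a j).val = if j.val ≤ a.val then j.val else j.val + 1 := by
  have := ZMod.val_lt j
  unfold vmap1
  split_ifs <;> exact ZMod.val_cast_of_lt (by omega)

theorem val_vmap2 {n : ℕ} [NeZero n] (a b j : ZMod n) :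
    (vmap2 n a b j).val =
      if j.val ≤ a.val then j.val else if j.val ≤ b.val then j.val + 1 else j.val + 2 := by
  have := ZMod.val_lt j
  unfold vmap2
  split_ifs <;> exact ZMod.val_cast_of_lt (by omega)

theorem CrossesDiagonals.op1 {n : ℕ} [NeZero n] (hn : 4 ≤ n) {B : Finset (Sym2 (ZMod n))}
    (h : CrossesDiagonals n B) (a u : ZMod n)
    (hua : u.val ≠ a.val) (hua1 : u.val ≠ a.val + 1) (hw : ¬ (a.val + 1 = n ∧ u.val = 0)) :
    CrossesDiagonals (n + 1) (op1Braces n a u B) := by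
  intro s t hst htn hne
  have han := ZMod.val_lt a
  have hun := ZMod.val_lt u
  have hk : ((a.val + 1 : ℕ) : ZMod (n + 1)).val = a.val + 1 :=
    ZMod.val_cast_of_lt (by omega)
  have hmem : s(((a.val + 1 : ℕ) : ZMod (n + 1)), vmap1 n a u) ∈ op1Braces n a u B :=
    Finset.mem_insert_self _ _
  have hmem' := hmem
  rw [Sym2.eq_swap] at hmem'
  have hu := val_vmap1 a u
  have transfer : ∀ s' t' : ℕ, s' + 1 < t' → t' < n → (s' ≠ 0 ∨ t' + 1 ≠ n) →
      (∀ x y : ZMod n, s' < x.val → x.val < t' → y.val < s' ∨ t' < y.val →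
        (s < (vmap1 n a x).val ∧ (vmap1 n a x).val < t ∧
          ((vmap1 n a y).val < s ∨ t < (vmap1 n a y).val)) ∨
        (s < (vmap1 n a y).val ∧ (vmap1 n a y).val < t ∧
          ((vmap1 n a x).val < s ∨ t < (vmap1 n a x).val))) →
      ∃ x y : ZMod (n + 1), s(x, y) ∈ op1Braces n a u B ∧ s < x.val ∧ x.val < t ∧
        (y.val < s ∨ t < y.val) := by
    intro s' t' h1 h2 h3 h4
    obtain ⟨x, y, hxy, h5, h6, h7⟩ := h s' t' h1 h2 h3
    have hm : s(vmap1 n a x, vmap1 n a y) ∈ op1Braces n a u B :=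
      Finset.mem_insert_of_mem (Finset.mem_image.2 ⟨_, hxy, rfl⟩)
    rcases h4 x y h5 h6 h7 with h8 | h8
    · exact ⟨_, _, hm, h8⟩
    · exact ⟨_, _, by rwa [Sym2.eq_swap], h8⟩
  rcases lt_trichotomy t (a.val + 1) with ht | ht | ht
  · by_cases hv : s ≠ 0 ∨ t + 1 ≠ n
    · refine transfer s t hst (by omega) hv fun x y _ _ _ => ?_
      rw [val_vmap1, val_vmap1]
      split_ifs <;> omega
    · refine ⟨_, _, hmem', ?_⟩
      rw [hk, hu]
      split_ifs <;> omega
  · by_cases h1 : s + 1 < a.val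
    · refine transfer s a.val h1 han (by omega) fun x y _ _ _ => ?_
      rw [val_vmap1, val_vmap1]
      split_ifs <;> omega
    · by_cases h2 : a.val + 1 < n
      · refine transfer s (a.val + 1) (by omega) h2 (by omega) fun x y _ _ _ => ?_
        rw [val_vmap1, val_vmap1]
        split_ifs <;> omega
      · refine transfer 0 s (by omega) (by omega) (by omega) fun x y _ _ _ => ?_
        have := ZMod.val_lt x
        have := ZMod.val_lt y
        rw [val_vmap1, val_vmap1]
        split_ifs <;> omega
  rcases lt_trichotomy s (a.val + 1) with hs | hs | hs
  · by_cases hv : s + 1 < t - 1 ∧ (s ≠ 0 ∨ t ≠ n)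
    · refine transfer s (t - 1) hv.1 (by omega) (by omega) fun x y _ _ _ => ?_
      rw [val_vmap1, val_vmap1]
      split_ifs <;> omega
    · refine ⟨_, _, hmem, ?_⟩
      rw [hk, hu]
      split_ifs <;> omega
  · by_cases hv : a.val ≠ 0 ∨ t ≠ n
    · refine transfer a.val (t - 1) (by omega) (by omega) (by omega) fun x y _ _ _ => ?_
      rw [val_vmap1, val_vmap1]
      split_ifs <;> omega
    · refine transfer (a.val + 1) (t - 1) (by omega) (by omega) (by omega) fun x y _ _ _ => ?_
      rw [val_vmap1, val_vmap1]
      split_ifs <;> omega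
  · refine transfer (s - 1) (t - 1) (by omega) (by omega) (by omega) fun x y _ _ _ => ?_
    rw [val_vmap1, val_vmap1]
    split_ifs <;> omega

theorem CrossesDiagonals.op2 {n : ℕ} [NeZero n] (hn : 4 ≤ n) {B : Finset (Sym2 (ZMod n))}
    (h : CrossesDiagonals n B) (a b : ZMod n) (hab : a.val < b.val) :
    CrossesDiagonals (n + 2) (op2Braces n a b B) := by
  intro s t hst htn hne
  have hbn := ZMod.val_lt b
  have hk₁ : ((a.val + 1 : ℕ) : ZMod (n + 2)).val = a.val + 1 :=
    ZMod.val_cast_of_lt (by omega)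
  have hk₂ : ((b.val + 2 : ℕ) : ZMod (n + 2)).val = b.val + 2 :=
    ZMod.val_cast_of_lt (by omega)
  have hmem : s(((a.val + 1 : ℕ) : ZMod (n + 2)), ((b.val + 2 : ℕ) : ZMod (n + 2))) ∈
      op2Braces n a b B := Finset.mem_insert_self _ _
  have hmem' := hmem
  rw [Sym2.eq_swap] at hmem'
  have transfer : ∀ s' t' : ℕ, s' + 1 < t' → t' < n → (s' ≠ 0 ∨ t' + 1 ≠ n) →
      (∀ x y : ZMod n, s' < x.val → x.val < t' → y.val < s' ∨ t' < y.val →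
        (s < (vmap2 n a b x).val ∧ (vmap2 n a b x).val < t ∧
          ((vmap2 n a b y).val < s ∨ t < (vmap2 n a b y).val)) ∨
        (s < (vmap2 n a b y).val ∧ (vmap2 n a b y).val < t ∧
          ((vmap2 n a b x).val < s ∨ t < (vmap2 n a b x).val))) →
      ∃ x y : ZMod (n + 2), s(x, y) ∈ op2Braces n a b B ∧ s < x.val ∧ x.val < t ∧
        (y.val < s ∨ t < y.val) := by
    intro s' t' h1 h2 h3 h4
    obtain ⟨x, y, hxy, h5, h6, h7⟩ := h s' t' h1 h2 h3
    have hm : s(vmap2 n a b x, vmap2 n a b y) ∈ op2Braces n a b B :=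
      Finset.mem_insert_of_mem (Finset.mem_image.2 ⟨_, hxy, rfl⟩)
    rcases h4 x y h5 h6 h7 with h8 | h8
    · exact ⟨_, _, hm, h8⟩
    · exact ⟨_, _, by rwa [Sym2.eq_swap], h8⟩
  by_cases hsep : (s < a.val + 1 ∧ a.val + 1 < t ∧ (b.val + 2 < s ∨ t < b.val + 2)) ∨
      (s < b.val + 2 ∧ b.val + 2 < t ∧ (a.val + 1 < s ∨ t < a.val + 1))
  · rcases hsep with h | h
    · exact ⟨_, _, hmem, by rwa [hk₁, hk₂]⟩
    · exact ⟨_, _, hmem', by rwa [hk₁, hk₂]⟩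
  by_cases hs₁ : s = a.val + 1
  · by_cases ht₂ : t = b.val + 2
    · by_cases hadj : a.val + 1 = b.val
      · by_cases hlast : a.val + 2 < n
        · refine transfer a.val (a.val + 2) (by omega) (by omega) (by omega) fun x y _ _ _ => ?_
          rw [val_vmap2, val_vmap2]
          split_ifs <;> omega
        · refine transfer 0 a.val (by omega) (by omega) (by omega) fun x y _ _ _ => ?_
          have := ZMod.val_lt x
          have := ZMod.val_lt y
          rw [val_vmap2, val_vmap2]
          split_ifs <;> omega
      · by_cases hwrap : a.val = 0 ∧ b.val + 1 = n
        · refine transfer 1 b.val (by omega) (by omega) (by omega) fun x y _ _ _ => ?_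
          rw [val_vmap2, val_vmap2]
          split_ifs <;> omega
        · refine transfer a.val b.val (by omega) (by omega) (by omega) fun x y _ _ _ => ?_
          rw [val_vmap2, val_vmap2]
          split_ifs <;> omega
    by_cases ht : t < b.val + 2
    · by_cases hwrap : a.val = 0 ∧ t = n
      · refine transfer 1 (t - 1) (by omega) (by omega) (by omega) fun x y _ _ _ => ?_
        rw [val_vmap2, val_vmap2]
        split_ifs <;> omega
      · refine transfer a.val (t - 1) (by omega) (by omega) (by omega) fun x y _ _ _ => ?_
        rw [val_vmap2, val_vmap2]
        split_ifs <;> omega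
    by_cases hwrap : a.val = 0 ∧ t = n + 1
    · refine transfer 1 (t - 2) (by omega) (by omega) (by omega) fun x y _ _ _ => ?_
      rw [val_vmap2, val_vmap2]
      split_ifs <;> omega
    · refine transfer a.val (t - 2) (by omega) (by omega) (by omega) fun x y _ _ _ => ?_
      rw [val_vmap2, val_vmap2]
      split_ifs <;> omega
  by_cases hs₂ : s = b.val + 2
  · refine transfer b.val (t - 2) (by omega) (by omega) (by omega) fun x y _ _ _ => ?_
    rw [val_vmap2, val_vmap2]
    split_ifs <;> omega
  by_cases ht₁ : t = a.val + 1
  · by_cases hlow : s + 1 < a.val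
    · refine transfer s a.val (by omega) (by omega) (by omega) fun x y _ _ _ => ?_
      rw [val_vmap2, val_vmap2]
      split_ifs <;> omega
    · refine transfer s (a.val + 1) (by omega) (by omega) (by omega) fun x y _ _ _ => ?_
      rw [val_vmap2, val_vmap2]
      split_ifs <;> omega
  by_cases ht₂ : t = b.val + 2
  · by_cases hs : s < a.val + 1
    · by_cases hlow : s + 1 < b.val
      · refine transfer s b.val (by omega) (by omega) (by omega) fun x y _ _ _ => ?_
        rw [val_vmap2, val_vmap2]
        split_ifs <;> omega
      by_cases hlast : b.val + 1 < n
      · refine transfer s (b.val + 1) (by omega) (by omega) (by omega) fun x y _ _ _ => ?_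
        rw [val_vmap2, val_vmap2]
        split_ifs <;> omega
      · refine transfer 0 s (by omega) (by omega) (by omega) fun x y _ _ _ => ?_
        have := ZMod.val_lt x
        have := ZMod.val_lt y
        rw [val_vmap2, val_vmap2]
        split_ifs <;> omega
    · by_cases hlow : s < b.val
      · refine transfer (s - 1) b.val (by omega) (by omega) (by omega) fun x y _ _ _ => ?_
        rw [val_vmap2, val_vmap2]
        split_ifs <;> omega
      by_cases hlast : b.val + 1 < n
      · refine transfer (s - 1) (b.val + 1) (by omega) (by omega) (by omega) fun x y _ _ _ => ?_
        rw [val_vmap2, val_vmap2]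
        split_ifs <;> omega
      · refine transfer 0 (s - 1) (by omega) (by omega) (by omega) fun x y _ _ _ => ?_
        have := ZMod.val_lt x
        have := ZMod.val_lt y
        rw [val_vmap2, val_vmap2]
        split_ifs <;> omega
  by_cases hs : s < a.val + 1
  · by_cases ht : t < a.val + 1
    · refine transfer s t (by omega) (by omega) (by omega) fun x y _ _ _ => ?_
      rw [val_vmap2, val_vmap2]
      split_ifs <;> omega
    by_cases ht' : t < b.val + 2
    · refine transfer s (t - 1) (by omega) (by omega) (by omega) fun x y _ _ _ => ?_
      rw [val_vmap2, val_vmap2]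
      split_ifs <;> omega
    · refine transfer s (t - 2) (by omega) (by omega) (by omega) fun x y _ _ _ => ?_
      rw [val_vmap2, val_vmap2]
      split_ifs <;> omega
  by_cases hs' : s < b.val + 2
  · by_cases ht : t < b.val + 2
    · refine transfer (s - 1) (t - 1) (by omega) (by omega) (by omega) fun x y _ _ _ => ?_
      rw [val_vmap2, val_vmap2]
      split_ifs <;> omega
    · refine transfer (s - 1) (t - 2) (by omega) (by omega) (by omega) fun x y _ _ _ => ?_
      rw [val_vmap2, val_vmap2]
      split_ifs <;> omega
  · refine transfer (s - 2) (t - 2) (by omega) (by omega) (by omega) fun x y _ _ _ => ?_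
    rw [val_vmap2, val_vmap2]
    split_ifs <;> omega

/-- A braced `m`-gon constructible by operations (1) and (2) and sitting inside the braced
`n`-gon `B`: the vertex labelled `i < m` is sent to `φ i`, the convention `φ m = n`
closing up the cycle. -/
structure EmbeddedConstruction (n : ℕ) (B : Finset (Sym2 (ZMod n))) (m : ℕ) (φ : ℕ → ℕ)
    (T : Finset (Sym2 (ZMod m))) : Prop where
  four_le : 4 ≤ m
  map_zero : φ 0 = 0
  map_last : φ m = n
  lt_succ : ∀ i < m, φ i < φ (i + 1)
  braces : ∀ x y : ZMod m, s(x, y) ∈ T → s((φ x.val : ZMod n), (φ y.val : ZMod n)) ∈ B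
  crosses : CrossesDiagonals m T
  constructible : BPConstructible false m T

namespace EmbeddedConstruction

variable {n m : ℕ} {B : Finset (Sym2 (ZMod n))} {φ : ℕ → ℕ} {T : Finset (Sym2 (ZMod m))}

theorem add_le (h : EmbeddedConstruction n B m φ T) (i d : ℕ) (hid : i + d ≤ m) :
    φ i + d ≤ φ (i + d) := by
  induction d with
  | zero => simp
  | succ d ih =>
    have := ih (by omega)
    have := h.lt_succ (i + d) (by omega)
    rw [← Nat.add_assoc i]
    omega

theorem lt_of_lt (h : EmbeddedConstruction n B m φ T) {i j : ℕ} (hij : i < j) (hj : j ≤ m) :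
    φ i < φ j := by
  have := h.add_le i (j - i) (by omega)
  rw [show i + (j - i) = j by omega] at this
  omega

theorem exists_gap (h : EmbeddedConstruction n B m φ T) (hmn : m < n) :
    ∃ i < m, φ i + 1 < φ (i + 1) := by
  by_contra! hno
  have key : ∀ i ≤ m, φ i ≤ i := by
    intro i hi
    induction i with
    | zero => exact h.map_zero.le
    | succ i ih =>
      have := ih (by omega)
      have := hno i (by omega)
      omega
  have := key m le_rfl
  have := h.map_last
  omega

theorem exists_mem_Ico (h : EmbeddedConstruction n B m φ T) {y : ℕ} (hy : y < n) :
    ∃ j < m, φ j ≤ y ∧ y < φ (j + 1) := by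
  have hP : ∃ k, k ≤ m ∧ y < φ k := ⟨m, le_rfl, by rwa [h.map_last]⟩
  classical
  have h1 := Nat.find_spec hP
  have h0 : Nat.find hP ≠ 0 := fun e => by
    rw [e, h.map_zero] at h1
    omega
  have h2 := Nat.find_min hP (m := Nat.find hP - 1) (by omega)
  refine ⟨Nat.find hP - 1, by omega, ?_, ?_⟩
  · by_contra hc
    exact h2 ⟨by omega, by omega⟩
  · rw [Nat.sub_add_cancel (by omega)]
    exact h1.2

theorem insert_one (h : EmbeddedConstruction n B m φ T) {i j x : ℕ} (hi : i < m) (hj : j < m)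
    (hji : j ≠ i) (hji1 : j ≠ i + 1) (hw : ¬ (i + 1 = m ∧ j = 0))
    (hx1 : φ i < x) (hx2 : x < φ (i + 1)) (hB : s((x : ZMod n), (φ j : ZMod n)) ∈ B) :
    ∃ φ' T', EmbeddedConstruction n B (m + 1) φ' T' := by
  have h4 := h.four_le
  have : NeZero m := ⟨by omega⟩
  have hiv : ((i : ℕ) : ZMod m).val = i := ZMod.val_cast_of_lt hi
  have hjv : ((j : ℕ) : ZMod m).val = j := ZMod.val_cast_of_lt hj
  have hk : ((((i : ℕ) : ZMod m).val + 1 : ℕ) : ZMod (m + 1)).val = i + 1 := by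
    rw [hiv]
    exact ZMod.val_cast_of_lt (by omega)
  have hu := val_vmap1 (i : ZMod m) (j : ZMod m)
  rw [hiv, hjv] at hu
  have hc := h.crosses.op1 h4 (i : ZMod m) (j : ZMod m) (by omega) (by omega) (by omega)
  let φ' : ℕ → ℕ := fun k => if k ≤ i then φ k else if k = i + 1 then x else φ (k - 1)
  have hφ' : ∀ z : ZMod m, φ' (vmap1 m i z).val = φ z.val := by
    intro z
    simp only [φ', val_vmap1, hiv]
    split_ifs <;> first | omega | rfl
  have hφk : φ' (i + 1) = x := by simp [φ']
  refine ⟨φ', op1Braces m i j T, by omega, ?_, ?_, ?_, ?_, hc,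
    BPConstructible.op1 _ _ h.constructible ⟨?_, ?_⟩ (hc.threeConnected (by omega))⟩
  · simp [φ', h.map_zero]
  · simp only [φ']
    rw [if_neg (by omega), if_neg (by omega)]
    exact h.map_last
  · intro k hk
    rcases lt_trichotomy k i with hki | rfl | hki
    · simp only [φ']
      rw [if_pos (by omega), if_pos (by omega)]
      exact h.lt_succ k (by omega)
    · rw [hφk]
      simpa [φ'] using hx1
    · rcases Nat.eq_or_lt_of_le (Nat.succ_le_of_lt hki) with rfl | hki'
      · rw [Nat.succ_eq_add_one, hφk]
        simp only [φ']
        rw [if_neg (by omega), if_neg (by omega)]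
        exact hx2
      · simp only [φ']
        rw [if_neg (by omega), if_neg (by omega), if_neg (by omega), if_neg (by omega)]
        have := h.lt_succ (k - 1) (by omega)
        rwa [show k - 1 + 1 = k + 1 - 1 by omega] at this
  · intro p q hpq
    rcases Finset.mem_insert.1 hpq with hpq | hpq
    · rcases Sym2.eq_iff.1 hpq with ⟨rfl, rfl⟩ | ⟨rfl, rfl⟩
      · rw [hk, hφk, hφ', hjv]
        exact hB
      · rw [hk, hφk, hφ', hjv, Sym2.eq_swap]
        exact hB
    · obtain ⟨e, he, hepq⟩ := Finset.mem_image.1 hpq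
      induction e using Sym2.ind with
      | _ u v =>
        have huv := h.braces u v he
        rw [Sym2.map_mk] at hepq
        rcases Sym2.eq_iff.1 hepq with ⟨rfl, rfl⟩ | ⟨rfl, rfl⟩
        · rw [hφ', hφ']
          exact huv
        · rw [hφ', hφ', Sym2.eq_swap]
          exact huv
  · rw [Sym2.mk_isDiag_iff]
    intro e
    have := congrArg ZMod.val e
    rw [hk, hu] at this
    split_ifs at this <;> omega
  · intro e
    have := e.val_cases (by omega)
    rw [hk] at this
    split_ifs at hu <;> omega

theorem insert_two (h : EmbeddedConstruction n B m φ T) {i j x y : ℕ} (hij : i < j)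
    (hj : j < m) (hx1 : φ i < x) (hx2 : x < φ (i + 1)) (hy1 : φ j < y) (hy2 : y < φ (j + 1))
    (hB : s((x : ZMod n), (y : ZMod n)) ∈ B) :
    ∃ φ' T', EmbeddedConstruction n B (m + 2) φ' T' := by
  have h4 := h.four_le
  have : NeZero m := ⟨by omega⟩
  have hiv : ((i : ℕ) : ZMod m).val = i := ZMod.val_cast_of_lt (by omega)
  have hjv : ((j : ℕ) : ZMod m).val = j := ZMod.val_cast_of_lt hj
  have hk₁ : ((((i : ℕ) : ZMod m).val + 1 : ℕ) : ZMod (m + 2)).val = i + 1 := by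
    rw [hiv]
    exact ZMod.val_cast_of_lt (by omega)
  have hk₂ : ((((j : ℕ) : ZMod m).val + 2 : ℕ) : ZMod (m + 2)).val = j + 2 := by
    rw [hjv]
    exact ZMod.val_cast_of_lt (by omega)
  have hlt : ((i : ℕ) : ZMod m).val < ((j : ℕ) : ZMod m).val := by omega
  have hc := h.crosses.op2 h4 (i : ZMod m) (j : ZMod m) hlt
  let φ' : ℕ → ℕ := fun k => if k ≤ i then φ k else if k = i + 1 then x else
    if k ≤ j + 1 then φ (k - 1) else if k = j + 2 then y else φ (k - 2)
  have hφ' : ∀ z : ZMod m, φ' (vmap2 m i j z).val = φ z.val := by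
    intro z
    simp only [φ', val_vmap2, hiv, hjv]
    split_ifs <;> first | rfl | omega
  have hφ₁ : φ' (i + 1) = x := by simp [φ']
  have hφ₂ : φ' (j + 2) = y := by
    simp only [φ']
    rw [if_neg (by omega), if_neg (by omega), if_neg (by omega), if_pos trivial]
  refine ⟨φ', op2Braces m i j T, by omega, ?_, ?_, ?_, ?_, hc,
    BPConstructible.op2 _ _ hlt h.constructible (hc.threeConnected (by omega))⟩
  · simp [φ', h.map_zero]
  · simp only [φ']
    rw [if_neg (by omega), if_neg (by omega), if_neg (by omega), if_neg (by omega)]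
    exact h.map_last
  · intro k hk
    have step := h.lt_succ
    by_cases h1 : k < i
    · simp only [φ']
      rw [if_pos (by omega), if_pos (by omega)]
      exact step k (by omega)
    by_cases h2 : k = i
    · subst h2
      rw [hφ₁]
      simpa [φ'] using hx1
    by_cases h3 : k = i + 1
    · subst h3
      rw [hφ₁]
      simp only [φ']
      rw [if_neg (by omega), if_neg (by omega), if_pos (by omega)]
      exact hx2
    by_cases h4 : k < j + 1
    · simp only [φ']
      rw [if_neg (by omega), if_neg (by omega), if_pos (by omega), if_neg (by omega),
        if_neg (by omega), if_pos (by omega)]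
      have := step (k - 1) (by omega)
      rwa [show k - 1 + 1 = k + 1 - 1 by omega] at this
    by_cases h5 : k = j + 1
    · subst h5
      rw [show j + 1 + 1 = j + 2 from rfl, hφ₂]
      simp only [φ']
      rw [if_neg (by omega), if_neg (by omega), if_pos (by omega)]
      exact hy1
    by_cases h6 : k = j + 2
    · subst h6
      rw [hφ₂]
      simp only [φ']
      rw [if_neg (by omega), if_neg (by omega), if_neg (by omega), if_neg (by omega)]
      exact hy2
    · simp only [φ']
      rw [if_neg (by omega), if_neg (by omega), if_neg (by omega), if_neg (by omega),
        if_neg (by omega), if_neg (by omega), if_neg (by omega), if_neg (by omega)]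
      have := step (k - 2) (by omega)
      rwa [show k - 2 + 1 = k + 1 - 2 by omega] at this
  · intro p q hpq
    rcases Finset.mem_insert.1 hpq with hpq | hpq
    · rcases Sym2.eq_iff.1 hpq with ⟨rfl, rfl⟩ | ⟨rfl, rfl⟩
      · rw [hk₁, hk₂, hφ₁, hφ₂]
        exact hB
      · rw [hk₁, hk₂, hφ₁, hφ₂, Sym2.eq_swap]
        exact hB
    · obtain ⟨e, he, hepq⟩ := Finset.mem_image.1 hpq
      induction e using Sym2.ind with
      | _ u v =>
        have huv := h.braces u v he
        rw [Sym2.map_mk] at hepq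
        rcases Sym2.eq_iff.1 hepq with ⟨rfl, rfl⟩ | ⟨rfl, rfl⟩
        · rw [hφ', hφ']
          exact huv
        · rw [hφ', hφ', Sym2.eq_swap]
          exact huv

theorem extend (h : EmbeddedConstruction n B m φ T) (hmn : m < n)
    (hB : CrossesDiagonals n B) :
    ∃ m' φ' T', m < m' ∧ EmbeddedConstruction n B m' φ' T' := by
  have h4 := h.four_le
  have h0 := h.map_zero
  have hlast := h.map_last
  have : NeZero n := ⟨by omega⟩
  obtain ⟨i, hi, hgap⟩ := h.exists_gap hmn
  obtain ⟨x, y, hxy, hx1, hx2, hy1, hy2⟩ : ∃ x y : ZMod n, s(x, y) ∈ B ∧ φ i < x.val ∧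
      x.val < φ (i + 1) ∧ (y.val < φ i ∨ φ (i + 1) < y.val) ∧
      ¬ (i + 1 = m ∧ y.val = 0) := by
    by_cases him : i + 1 = m
    · have h1 := h.lt_of_lt (i := 0) (j := 1) (by omega) (by omega)
      have h2 := h.lt_of_lt (i := 1) (j := i) (by omega) (by omega)
      rw [him, hlast] at hgap ⊢
      obtain ⟨x, y, hxy, hx1, hx2, hy⟩ := hB 0 (φ i) (by omega) (by omega) (by omega)
      have := ZMod.val_lt y
      exact ⟨y, x, by rwa [Sym2.eq_swap], by omega⟩
    · have h1 := h.lt_of_lt (i := i + 1) (j := m) (by omega) le_rfl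
      have h2 : φ i ≠ 0 ∨ φ (i + 1) + 1 ≠ n := by
        by_cases hi0 : i = 0
        · have := h.lt_of_lt (i := i + 1) (j := i + 2) (by omega) (by omega)
          have := h.lt_of_lt (i := i + 2) (j := m) (by omega) (by omega)
          omega
        · have := h.lt_of_lt (i := 0) (j := i) (by omega) (by omega)
          omega
      obtain ⟨x, y, hxy, hx1, hx2, hy⟩ := hB (φ i) (φ (i + 1)) hgap (by omega) h2
      exact ⟨x, y, hxy, by omega⟩
  obtain ⟨j, hj, hj1, hj2⟩ := h.exists_mem_Ico (ZMod.val_lt y)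
  have hxy' : s(((x.val : ℕ) : ZMod n), ((y.val : ℕ) : ZMod n)) ∈ B := by
    rwa [ZMod.natCast_zmod_val, ZMod.natCast_zmod_val]
  have hji : j ≠ i := by
    rintro rfl
    omega
  rcases Nat.eq_or_lt_of_le hj1 with hjy | hjy
  · rw [← hjy] at hxy'
    obtain ⟨φ', T', h'⟩ := h.insert_one hi hj hji (by rintro rfl; omega)
      (by
        rintro ⟨h1, rfl⟩
        omega) hx1 hx2 hxy'
    exact ⟨_, φ', T', by omega, h'⟩
  · rcases Nat.lt_or_gt_of_ne hji with hlt | hlt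
    · rw [Sym2.eq_swap] at hxy'
      obtain ⟨φ', T', h'⟩ := h.insert_two hlt hi hjy hj2 hx1 hx2 hxy'
      exact ⟨_, φ', T', by omega, h'⟩
    · obtain ⟨φ', T', h'⟩ := h.insert_two hlt hj hx1 hx2 hjy hj2 hxy'
      exact ⟨_, φ', T', by omega, h'⟩

theorem exists_spanning (h : EmbeddedConstruction n B m φ T) (hB : CrossesDiagonals n B) :
    ∃ φ' T', EmbeddedConstruction n B n φ' T' := by
  induction hd : n - m using Nat.strong_induction_on generalizing m φ T with
  | _ d ih =>
    have hle := h.add_le 0 m (by omega)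
    rw [h.map_zero, Nat.zero_add, h.map_last] at hle
    rcases Nat.eq_or_lt_of_le hle with rfl | hlt
    · exact ⟨φ, T, h⟩
    · obtain ⟨m', φ', T', hm', h'⟩ := h.extend hlt hB
      exact ih (n - m') (by omega) h' rfl

theorem subset_of_spanning {T : Finset (Sym2 (ZMod n))}
    (h : EmbeddedConstruction n B n φ T) : T ⊆ B := by
  have h4 := h.four_le
  have : NeZero n := ⟨by omega⟩
  have hid : ∀ i < n, φ i = i := by
    intro i hi
    have h1 := h.add_le 0 i (by omega)
    have h2 := h.add_le i (n - i) (by omega)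
    rw [h.map_zero, Nat.zero_add] at h1
    rw [show i + (n - i) = n by omega, h.map_last] at h2
    omega
  intro e he
  induction e using Sym2.ind with
  | _ u v =>
    have := h.braces u v he
    rwa [hid _ (ZMod.val_lt u), hid _ (ZMod.val_lt v), ZMod.natCast_zmod_val,
      ZMod.natCast_zmod_val] at this

end EmbeddedConstruction

theorem crossesDiagonals_square :
    CrossesDiagonals 4 {s((0 : ZMod 4), 2), s((1 : ZMod 4), 3)} := by
  intro s t h1 h2 h3
  have : (s = 0 ∧ t = 2) ∨ (s = 1 ∧ t = 3) := by omega
  rcases this with ⟨rfl, rfl⟩ | ⟨rfl, rfl⟩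
  · exact ⟨1, 3, by decide, by decide, by decide, by decide⟩
  · exact ⟨2, 0, by decide, by decide, by decide, by decide⟩

theorem CrossesDiagonals.exists_embeddedConstruction {n : ℕ} (hn : 4 ≤ n)
    {B : Finset (Sym2 (ZMod n))} (hB : CrossesDiagonals n B) :
    ∃ φ, EmbeddedConstruction n B 4 φ {s((0 : ZMod 4), 2), s((1 : ZMod 4), 3)} := by
  have : NeZero n := ⟨by omega⟩
  obtain ⟨z, y, hzy, hz, hy⟩ : ∃ z y : ZMod n, s(z, y) ∈ B ∧ z.val = 0 ∧
      1 < y.val ∧ y.val < n - 1 := by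
    obtain ⟨y, z, hyz, hy1, hy2, hz⟩ := hB 1 (n - 1) (by omega) (by omega) (by omega)
    have := ZMod.val_lt z
    exact ⟨z, y, by rwa [Sym2.eq_swap], by omega⟩
  obtain ⟨x, w, hxw, hx1, hx2, hw⟩ := hB 0 y.val (by omega) (by omega) (by omega)
  have hwn := ZMod.val_lt w
  let φ : ℕ → ℕ := fun k =>
    if k = 0 then 0 else if k = 1 then x.val else if k = 2 then y.val else
      if k = 3 then w.val else n
  have hφ0 : ((φ (0 : ZMod 4).val : ℕ) : ZMod n) = z := by
    rw [← ZMod.natCast_zmod_val z, hz]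
    rfl
  have hφ1 : ((φ (1 : ZMod 4).val : ℕ) : ZMod n) = x := ZMod.natCast_zmod_val x
  have hφ2 : ((φ (2 : ZMod 4).val : ℕ) : ZMod n) = y := ZMod.natCast_zmod_val y
  have hφ3 : ((φ (3 : ZMod 4).val : ℕ) : ZMod n) = w := ZMod.natCast_zmod_val w
  refine ⟨φ, le_rfl, rfl, rfl, ?_, ?_, crossesDiagonals_square, BPConstructible.base⟩
  · intro i hi
    interval_cases i
    · exact hx1
    · exact hx2
    · exact (by omega : y.val < w.val)
    · exact hwn
  · intro p q hpq
    simp only [Finset.mem_insert, Finset.mem_singleton, Sym2.eq_iff] at hpq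
    rcases hpq with (⟨rfl, rfl⟩ | ⟨rfl, rfl⟩) | (⟨rfl, rfl⟩ | ⟨rfl, rfl⟩)
    · rwa [hφ0, hφ2]
    · rwa [hφ0, hφ2, Sym2.eq_swap]
    · rwa [hφ1, hφ3]
    · rwa [hφ1, hφ3, Sym2.eq_swap]

theorem CrossesDiagonals.exists_constructible_subset {n : ℕ} (hn : 4 ≤ n)
    {B : Finset (Sym2 (ZMod n))} (hB : CrossesDiagonals n B) :
    ∃ T ⊆ B, CrossesDiagonals n T ∧ BPConstructible false n T := by
  obtain ⟨φ, h⟩ := hB.exists_embeddedConstruction hn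
  obtain ⟨φ', T, h'⟩ := h.exists_spanning hB
  exact ⟨T, h'.subset_of_spanning, h'.crosses, h'.constructible⟩

theorem BPConstructible.of_false {n : ℕ} {B : Finset (Sym2 (ZMod n))}
    (h : BPConstructible false n B) (allow3 : Bool) : BPConstructible allow3 n B := by
  induction h with
  | base => exact base
  | op1 a u _ hchord hconn ih => exact op1 a u ih hchord hconn
  | op2 a b hab _ hconn ih => exact op2 a b hab ih hconn
  | op3 c h3 => cases h3

theorem BPConstructible.union {n : ℕ} [NeZero n] (hn : 4 ≤ n)
    {T F : Finset (Sym2 (ZMod n))} (hT : BPConstructible true n T)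
    (hcross : CrossesDiagonals n T) (hF : ∀ e ∈ F, ¬ e.IsDiag ∧ ¬ IsBoundaryEdge n e) :
    BPConstructible true n (T ∪ F) := by
  induction F using Finset.induction_on with
  | empty => simpa using hT
  | insert e F _ ih =>
    have ih := ih fun e' he' => hF e' (Finset.mem_insert_of_mem he')
    rw [Finset.union_insert]
    by_cases he : e ∈ T ∪ F
    · rwa [Finset.insert_eq_of_mem he]
    · obtain ⟨h1, h2⟩ := hF e (Finset.mem_insert_self _ _)
      refine op3 e rfl ⟨h1, h2, he⟩ ih ((hcross.mono fun t ht => ?_).threeConnected hn)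
      exact Finset.mem_insert_of_mem (Finset.mem_union_left F ht)

/-- Every 3-connected braced polygon graph with at least 4 vertices
can be constructed from `K₄` by operations (1), (2) and (3), each step preserving
3-connectivity; if it is minimally 3-connected, operations (1) and (2) suffice. -/
theorem stmt12 (n : ℕ) [NeZero n] (hn : 4 ≤ n) (B : Finset (Sym2 (ZMod n)))
    (hB : ∀ e ∈ B, ¬ e.IsDiag ∧ ¬ IsBoundaryEdge n e)
    (h3 : ThreeConnected (bpGraph n B)) :
    BPConstructible true n B ∧
      (MinThreeConnectedBP n B → BPConstructible false n B) := by
  obtain ⟨T, hTB, hcross, hT⟩ := h3.crossesDiagonals.exists_constructible_subset hn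
  constructor
  · have := (hT.of_false true).union hn hcross hB
    rwa [Finset.union_eq_right.2 hTB] at this
  · rintro ⟨_, hmin⟩
    suffices T = B from this ▸ hT
    refine hTB.antisymm fun e he => ?_
    by_contra heT
    exact hmin e he ((hcross.mono (Finset.subset_erase.2 ⟨hTB, heT⟩)).threeConnected hn)
end

section
/- Let G be a minimally 3-connected braced polygon graph on n vertices with m edges, and suppose m ≥ 2n - 2. Then m = 2n - 2 and G is a generic rigidity circuit: every proper subgraph on k vertices (2 ≤ k < n) has at most 2k - 3 edges. -/
/-- `c` lies strictly between `a` and `b`. -/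
def StrictlyInside (a b c : ℕ) : Prop := a < c ∧ c < b ∨ b < c ∧ c < a

/-- `c` lies strictly outside the interval spanned by `a` and `b`. -/
def StrictlyOutside (a b c : ℕ) : Prop := c < a ∧ c < b ∨ a < c ∧ b < c

/-- The chords `{a, b}` and `{c, d}` of a convex polygon with vertices labelled in order by
natural numbers cross. -/
def ChordsCross (a b c d : ℕ) : Prop :=
  StrictlyInside a b c ∧ StrictlyOutside a b d ∨ StrictlyInside a b d ∧ StrictlyOutside a b c

theorem ChordsCross.swap_right {a b c d : ℕ} (h : ChordsCross a b c d) : ChordsCross a b d c :=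
  Or.symm h

/-- Every chord in `B` (with ends in `T`) is the unique chord of `B` crossing some chord
with ends in `T`; the cyclic order of the vertices is that of their labels under `φ`. -/
structure UniquelyCrossed {V : Type*} (φ : V → ℕ) (T : Finset V) (B : Finset (V × V)) :
    Prop where
  mem : ∀ e ∈ B, e.1 ∈ T ∧ e.2 ∈ T
  witness : ∀ e ∈ B, ∃ c ∈ T, ∃ d ∈ T, ChordsCross (φ e.1) (φ e.2) (φ c) (φ d) ∧
    ∀ f ∈ B, ChordsCross (φ f.1) (φ f.2) (φ c) (φ d) → f = e

namespace UniquelyCrossed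

variable {V : Type*} {φ : V → ℕ} {T : Finset V} {B : Finset (V × V)}

/-- The witness can be chosen with its first end inside and its second end outside. -/
theorem exists_witness (h : UniquelyCrossed φ T B) {e : V × V} (he : e ∈ B) :
    ∃ c ∈ T, ∃ d ∈ T, StrictlyInside (φ e.1) (φ e.2) (φ c) ∧
      StrictlyOutside (φ e.1) (φ e.2) (φ d) ∧
      ∀ f ∈ B, ChordsCross (φ f.1) (φ f.2) (φ c) (φ d) → f = e := by
  obtain ⟨c, hc, d, hd, ⟨h1, h2⟩ | ⟨h1, h2⟩, hf⟩ := h.witness e he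
  · exact ⟨c, hc, d, hd, h1, h2, hf⟩
  · exact ⟨d, hd, c, hc, h1, h2, fun f hfB hx => hf f hfB hx.swap_right⟩

theorem subset (h : UniquelyCrossed φ T B) {B' : Finset (V × V)} (hB : B' ⊆ B) :
    UniquelyCrossed φ T B' := by
  refine ⟨fun e he => h.mem e (hB he), fun e he => ?_⟩
  obtain ⟨c, hc, d, hd, hx, hf⟩ := h.witness e (hB he)
  exact ⟨c, hc, d, hd, hx, fun f hf' => hf f (hB hf')⟩

theorem ne (h : UniquelyCrossed φ T B) {e : V × V} (he : e ∈ B) : e.1 ≠ e.2 := by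
  intro heq
  obtain ⟨c, -, d, -, h1, -⟩ := h.exists_witness he
  rw [heq] at h1
  unfold StrictlyInside at h1
  omega

/-- Crossing is invariant under cyclic relabelling, so any vertex may be taken to be first. -/
theorem rotate (h : UniquelyCrossed φ T B) (g : V) {M : ℕ} (hM : ∀ x ∈ T, φ x < M) :
    UniquelyCrossed (fun x => if φ x < φ g then φ x + M else φ x) T B := by
  have key : ∀ a ∈ T, ∀ b ∈ T, ∀ c ∈ T, ∀ d ∈ T,
      ChordsCross (if φ a < φ g then φ a + M else φ a) (if φ b < φ g then φ b + M else φ b)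
        (if φ c < φ g then φ c + M else φ c) (if φ d < φ g then φ d + M else φ d) ↔
      ChordsCross (φ a) (φ b) (φ c) (φ d) := by
    intro a ha b hb c hc d hd
    have := hM a ha
    have := hM b hb
    have := hM c hc
    have := hM d hd
    unfold ChordsCross StrictlyInside StrictlyOutside
    split_ifs <;> omega
  refine ⟨h.mem, fun e he => ?_⟩
  obtain ⟨c, hc, d, hd, hx, hf⟩ := h.witness e he
  refine ⟨c, hc, d, hd, (key _ (h.mem e he).1 _ (h.mem e he).2 _ hc _ hd).2 hx,
    fun f hfB hfx => hf f hfB ?_⟩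
  exact (key _ (h.mem f hfB).1 _ (h.mem f hfB).2 _ hc _ hd).1 hfx

variable [DecidableEq V]

/-- Removing an unused vertex `g` which comes first in the order, when the chord joining its two
neighbours `v` and `u` is absent. -/
theorem erase_first (h : UniquelyCrossed φ T B) (hφ : Set.InjOn φ T) {g u v : V}
    (hu : u ∈ T.erase g) (hv : v ∈ T.erase g)
    (hmin : ∀ x ∈ T.erase g, φ g < φ x) (humax : ∀ x ∈ T.erase g, φ x ≤ φ u)
    (hvmin : ∀ x ∈ T.erase g, φ v ≤ φ x)
    (hg : ∀ e ∈ B, e.1 ≠ g ∧ e.2 ≠ g)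
    (huv : ∀ e ∈ B, ¬ ((e.1 = u ∨ e.2 = u) ∧ (e.1 = v ∨ e.2 = v))) :
    UniquelyCrossed φ (T.erase g) B := by
  have hmem : ∀ e ∈ B, e.1 ∈ T.erase g ∧ e.2 ∈ T.erase g := fun e he =>
    ⟨Finset.mem_erase.2 ⟨(hg e he).1, (h.mem e he).1⟩,
      Finset.mem_erase.2 ⟨(hg e he).2, (h.mem e he).2⟩⟩
  refine ⟨hmem, fun e he => ?_⟩
  have hinj : ∀ x ∈ T.erase g, ∀ y ∈ T.erase g, x ≠ y → φ x ≠ φ y := fun x hx y hy hxy he =>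
    hxy (hφ (Finset.mem_of_mem_erase hx) (Finset.mem_of_mem_erase hy) he)
  obtain ⟨c, hc, d, hd, h1, h2, hf⟩ := h.exists_witness he
  obtain ⟨he1, he2⟩ := hmem e he
  have hcg : c ≠ g := by
    rintro rfl
    have := hmin _ he1
    have := hmin _ he2
    unfold StrictlyInside at h1
    omega
  have hc' : c ∈ T.erase g := Finset.mem_erase.2 ⟨hcg, hc⟩
  by_cases hdg : d = g
  · subst hdg
    by_cases hev : e.1 = v ∨ e.2 = v
    · have heu : ¬ (e.1 = u ∨ e.2 = u) := fun h => huv e he ⟨h, hev⟩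
      push Not at heu
      refine ⟨c, hc', u, hu, Or.inl ⟨h1, ?_⟩, fun f hfB hx => hf f hfB ?_⟩
      · have := humax _ he1
        have := humax _ he2
        have := hinj _ he1 _ hu heu.1
        have := hinj _ he2 _ hu heu.2
        unfold StrictlyOutside
        omega
      · have := humax _ (hmem f hfB).1
        have := humax _ (hmem f hfB).2
        have := hmin _ (hmem f hfB).1
        have := hmin _ (hmem f hfB).2
        unfold ChordsCross StrictlyInside StrictlyOutside at *
        omega
    · push Not at hev
      refine ⟨c, hc', v, hv, Or.inl ⟨h1, ?_⟩, fun f hfB hx => hf f hfB ?_⟩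
      · have := hvmin _ he1
        have := hvmin _ he2
        have := hinj _ he1 _ hv hev.1
        have := hinj _ he2 _ hv hev.2
        unfold StrictlyOutside
        omega
      · have := hvmin _ (hmem f hfB).1
        have := hvmin _ (hmem f hfB).2
        have := hmin _ (hmem f hfB).1
        have := hmin _ (hmem f hfB).2
        unfold ChordsCross StrictlyInside StrictlyOutside at *
        omega
  · exact ⟨c, hc', d, Finset.mem_erase.2 ⟨hdg, hd⟩, Or.inl ⟨h1, h2⟩, hf⟩

/-- Restricting to the vertices in an interval, together with the first vertex `g`. -/
theorem restrict_interval (h : UniquelyCrossed φ T B) {g : V} (hgT : g ∈ T)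
    (hmin : ∀ x ∈ T.erase g, φ g < φ x) (hg : ∀ e ∈ B, e.1 ≠ g ∧ e.2 ≠ g) (l r : ℕ) :
    UniquelyCrossed φ (T.filter fun x => x = g ∨ l ≤ φ x ∧ φ x ≤ r)
      (B.filter fun e => (l ≤ φ e.1 ∧ φ e.1 ≤ r) ∧ (l ≤ φ e.2 ∧ φ e.2 ≤ r)) := by
  have hgt : ∀ e ∈ B, φ g < φ e.1 ∧ φ g < φ e.2 := fun e he =>
    ⟨hmin _ (Finset.mem_erase.2 ⟨(hg e he).1, (h.mem e he).1⟩),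
      hmin _ (Finset.mem_erase.2 ⟨(hg e he).2, (h.mem e he).2⟩)⟩
  refine ⟨fun e he => ?_, fun e he => ?_⟩
  · obtain ⟨heB, h1, h2⟩ := Finset.mem_filter.1 he
    exact ⟨Finset.mem_filter.2 ⟨(h.mem e heB).1, Or.inr h1⟩,
      Finset.mem_filter.2 ⟨(h.mem e heB).2, Or.inr h2⟩⟩
  · obtain ⟨heB, h1, h2⟩ := Finset.mem_filter.1 he
    obtain ⟨c, hc, d, hd, hi, ho, hf⟩ := h.exists_witness heB
    have hc' : l ≤ φ c ∧ φ c ≤ r := by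
      unfold StrictlyInside at hi
      omega
    by_cases hd' : d = g ∨ l ≤ φ d ∧ φ d ≤ r
    · exact ⟨c, Finset.mem_filter.2 ⟨hc, Or.inr hc'⟩, d, Finset.mem_filter.2 ⟨hd, hd'⟩,
        Or.inl ⟨hi, ho⟩, fun f hfB => hf f (Finset.mem_of_mem_filter f hfB)⟩
    · push Not at hd'
      refine ⟨c, Finset.mem_filter.2 ⟨hc, Or.inr hc'⟩, g, Finset.mem_filter.2 ⟨hgT, Or.inl rfl⟩,
        Or.inl ⟨hi, Or.inl (hgt e heB)⟩, fun f hfB hx => ?_⟩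
      obtain ⟨hfB, h3, h4⟩ := Finset.mem_filter.1 hfB
      refine hf f hfB ?_
      have := hgt f hfB
      have := hd'.2
      unfold ChordsCross StrictlyInside StrictlyOutside at *
      omega

theorem eq_empty (h : UniquelyCrossed φ T B) (hT : T.card ≤ 2) : B = ∅ := by
  by_contra hne
  obtain ⟨e, he⟩ := Finset.nonempty_iff_ne_empty.2 hne
  obtain ⟨c, hc, d, hd, hi, -⟩ := h.exists_witness he
  have hsub : ({e.1, e.2, c} : Finset V) ⊆ T := by
    have := h.mem e he
    intro x hx
    simp only [Finset.mem_insert, Finset.mem_singleton] at hx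
    grind
  have h1 : e.1 ≠ c := by
    rintro h'
    rw [h'] at hi
    unfold StrictlyInside at hi
    omega
  have h2 : e.2 ≠ c := by
    rintro h'
    rw [h'] at hi
    unfold StrictlyInside at hi
    omega
  have := Finset.card_le_card hsub
  rw [Finset.card_eq_three.2 ⟨e.1, e.2, c, h.ne he, h1, h2, rfl⟩] at this
  omega

/-- The bound for families of chords avoiding a vertex, from the bounds for smaller polygons. -/
theorem card_add_three_le_of_first (hφ : Set.InjOn φ T)
    (ih2 : ∀ (T' : Finset V) (B' : Finset (V × V)), T' ⊂ T → 2 ≤ T'.card →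
      UniquelyCrossed φ T' B' → B'.card + 2 ≤ T'.card)
    (ih3 : ∀ (T' : Finset V) (B' : Finset (V × V)) (g : V), T' ⊂ T → 3 ≤ T'.card → g ∈ T' →
      (∀ e ∈ B', e.1 ≠ g ∧ e.2 ≠ g) → UniquelyCrossed φ T' B' → B'.card + 3 ≤ T'.card)
    (h : UniquelyCrossed φ T B) (hT : 3 ≤ T.card) {g : V} (hgT : g ∈ T)
    (hmin : ∀ x ∈ T.erase g, φ g < φ x) (hg : ∀ e ∈ B, e.1 ≠ g ∧ e.2 ≠ g) :
    B.card + 3 ≤ T.card := by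
  have hcard := Finset.card_erase_of_mem hgT
  have hne : (T.erase g).Nonempty := Finset.card_pos.1 (by omega)
  obtain ⟨u, hu, humax⟩ := Finset.exists_max_image (T.erase g) φ hne
  obtain ⟨v, hv, hvmin⟩ := Finset.exists_min_image (T.erase g) φ hne
  by_cases huv : ∀ e ∈ B, ¬ ((e.1 = u ∨ e.2 = u) ∧ (e.1 = v ∨ e.2 = v))
  · have := ih2 _ B (Finset.erase_ssubset hgT) (by omega)
      (h.erase_first hφ hu hv hmin humax hvmin hg huv)
    omega
  push Not at huv
  obtain ⟨e, he, heu, hev⟩ := huv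
  obtain ⟨j, hj, d, hd, hi, ho, hf⟩ := h.exists_witness he
  have huT := Finset.mem_of_mem_erase hu
  have hvT := Finset.mem_of_mem_erase hv
  have hegt : ∀ f ∈ B, f.1 ∈ T.erase g ∧ f.2 ∈ T.erase g := fun f hfB =>
    ⟨Finset.mem_erase.2 ⟨(hg f hfB).1, (h.mem f hfB).1⟩,
      Finset.mem_erase.2 ⟨(hg f hfB).2, (h.mem f hfB).2⟩⟩
  have hvj : φ v < φ j ∧ φ j < φ u := by
    have h1 := humax _ (hegt e he).1
    have h2 := humax _ (hegt e he).2
    have h3 := hvmin _ (hegt e he).1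
    have h4 := hvmin _ (hegt e he).2
    unfold StrictlyInside at hi
    omega
  have hdg : d = g := by
    by_contra hne
    have hd' : d ∈ T.erase g := Finset.mem_erase.2 ⟨hne, hd⟩
    have h1 := humax _ hd'
    have h2 := hvmin _ hd'
    have h3 : e.1 = u ∧ e.2 = v ∨ e.1 = v ∧ e.2 = u := by
      have hnuv : u ≠ v := by
        rintro rfl
        omega
      grind
    unfold StrictlyOutside at ho
    rcases h3 with ⟨h3, h4⟩ | ⟨h3, h4⟩ <;> rw [h3, h4] at ho <;> omega
  subst hdg
  have hgv := hmin v hv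
  have h1 := h.restrict_interval hgT hmin hg (φ v) (φ j)
  have h2 := h.restrict_interval hgT hmin hg (φ j) (φ u)
  set T₁ := T.filter fun x => x = d ∨ φ v ≤ φ x ∧ φ x ≤ φ j with hT₁
  set T₂ := T.filter fun x => x = d ∨ φ j ≤ φ x ∧ φ x ≤ φ u with hT₂
  set B₁ := B.filter fun e => (φ v ≤ φ e.1 ∧ φ e.1 ≤ φ j) ∧ (φ v ≤ φ e.2 ∧ φ e.2 ≤ φ j) with hB₁
  set B₂ := B.filter fun e => (φ j ≤ φ e.1 ∧ φ e.1 ≤ φ u) ∧ (φ j ≤ φ e.2 ∧ φ e.2 ≤ φ u) with hB₂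
  have hdT₁ : d ∈ T₁ := Finset.mem_filter.2 ⟨hgT, Or.inl rfl⟩
  have hdT₂ : d ∈ T₂ := Finset.mem_filter.2 ⟨hgT, Or.inl rfl⟩
  have hjT₁ : j ∈ T₁ := Finset.mem_filter.2 ⟨hj, Or.inr ⟨hvj.1.le, le_rfl⟩⟩
  have hjT₂ : j ∈ T₂ := Finset.mem_filter.2 ⟨hj, Or.inr ⟨le_rfl, hvj.2.le⟩⟩
  have hvT₁ : v ∈ T₁ := Finset.mem_filter.2 ⟨hvT, Or.inr ⟨le_rfl, hvj.1.le⟩⟩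
  have huT₂ : u ∈ T₂ := Finset.mem_filter.2 ⟨huT, Or.inr ⟨hvj.2.le, le_rfl⟩⟩
  have huT₁ : u ∉ T₁ := by
    rw [hT₁, Finset.mem_filter]
    rintro ⟨-, rfl | h'⟩ <;> omega
  have hvT₂ : v ∉ T₂ := by
    rw [hT₂, Finset.mem_filter]
    rintro ⟨-, rfl | h'⟩ <;> omega
  have hdj : d ≠ j := by rintro rfl; omega
  have hss₁ : T₁ ⊂ T := ⟨Finset.filter_subset _ _, fun h' => huT₁ (h' huT)⟩
  have hss₂ : T₂ ⊂ T := ⟨Finset.filter_subset _ _, fun h' => hvT₂ (h' hvT)⟩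
  have hc₁ : 3 ≤ T₁.card := by
    refine Finset.two_lt_card.2 ⟨d, hdT₁, j, hjT₁, v, hvT₁, hdj, ?_, ?_⟩ <;> rintro rfl <;> omega
  have hc₂ : 3 ≤ T₂.card := by
    refine Finset.two_lt_card.2 ⟨d, hdT₂, j, hjT₂, u, huT₂, hdj, ?_, ?_⟩ <;> rintro rfl <;> omega
  have hb₁ : B₁.card + 3 ≤ T₁.card :=
    ih3 _ _ d hss₁ hc₁ hdT₁ (fun f hfB => hg f (Finset.mem_of_mem_filter f hfB)) h1
  have hb₂ : B₂.card + 3 ≤ T₂.card :=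
    ih3 _ _ d hss₂ hc₂ hdT₂ (fun f hfB => hg f (Finset.mem_of_mem_filter f hfB)) h2
  have hBsub : B ⊆ insert e (B₁ ∪ B₂) := by
    intro f hfB
    by_cases hfe : f = e
    · exact hfe ▸ Finset.mem_insert_self _ _
    have hnc : ¬ ChordsCross (φ f.1) (φ f.2) (φ j) (φ d) := fun hx => hfe (hf f hfB hx)
    have a1 := humax _ (hegt f hfB).1
    have a2 := humax _ (hegt f hfB).2
    have a3 := hvmin _ (hegt f hfB).1
    have a4 := hvmin _ (hegt f hfB).2
    refine Finset.mem_insert_of_mem ?_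
    rw [Finset.mem_union, hB₁, hB₂, Finset.mem_filter, Finset.mem_filter]
    simp only [hfB, true_and]
    unfold ChordsCross StrictlyInside StrictlyOutside at hnc
    omega
  have hBc := Finset.card_le_card hBsub
  have hBi := Finset.card_insert_le e (B₁ ∪ B₂)
  have hBu := Finset.card_union_le B₁ B₂
  have hTi : T₁ ∩ T₂ ⊆ {d, j} := by
    intro x hx
    obtain ⟨hx1, hx2⟩ := Finset.mem_inter.1 hx
    obtain ⟨hxT, hx1⟩ := Finset.mem_filter.1 hx1
    obtain ⟨-, hx2⟩ := Finset.mem_filter.1 hx2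
    rw [Finset.mem_insert, Finset.mem_singleton]
    by_cases hxd : x = d
    · exact Or.inl hxd
    · refine Or.inr (hφ hxT hj ?_)
      simp only [hxd, false_or] at hx1 hx2
      omega
  have hTc := Finset.card_le_card hTi
  rw [Finset.card_pair hdj] at hTc
  have hTu := Finset.card_union_add_card_inter T₁ T₂
  have hTs := Finset.card_le_card (Finset.union_subset hss₁.1 hss₂.1)
  omega

theorem card_add_two_le_of_avoiding (h : UniquelyCrossed φ T B) (hT : 3 ≤ T.card)
    (hav : ∀ g ∈ T, (B.filter fun e => g ≠ e.1 ∧ g ≠ e.2).card + 3 ≤ T.card) :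
    B.card + 2 ≤ T.card := by
  have hdc := Finset.sum_card_bipartiteAbove_eq_sum_card_bipartiteBelow
    (fun (g : V) (e : V × V) => g ≠ e.1 ∧ g ≠ e.2) (s := T) (t := B)
  have hl : ∑ g ∈ T, (Finset.bipartiteAbove (fun (g : V) (e : V × V) => g ≠ e.1 ∧ g ≠ e.2)
      B g).card ≤ T.card * (T.card - 3) :=
    Finset.sum_le_card_nsmul _ _ _ fun g hg => Nat.le_sub_of_add_le (hav g hg)
  have hr : B.card * (T.card - 2) ≤ ∑ e ∈ B,
      (Finset.bipartiteBelow (fun (g : V) (e : V × V) => g ≠ e.1 ∧ g ≠ e.2) T e).card := by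
    refine Finset.card_nsmul_le_sum _ _ _ fun e he => ?_
    have : Finset.bipartiteBelow (fun (g : V) (e : V × V) => g ≠ e.1 ∧ g ≠ e.2) T e
        = T \ {e.1, e.2} := by
      ext x
      simp [Finset.bipartiteBelow]
    rw [this]
    have := Finset.le_card_sdiff {e.1, e.2} T
    rw [Finset.card_pair (h.ne he)] at this
    exact this
  obtain ⟨t, ht⟩ : ∃ t, T.card = t + 3 := ⟨T.card - 3, by omega⟩
  rw [ht] at hl hr ⊢
  simp only [Nat.add_sub_cancel, show t + 3 - 2 = t + 1 by omega] at hl hr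
  by_contra hcon
  have : t + 2 ≤ B.card := by omega
  nlinarith

end UniquelyCrossed

open UniquelyCrossed in
theorem UniquelyCrossed.card_bounds {V : Type*} [DecidableEq V] (T : Finset V) :
    ∀ (φ : V → ℕ) (B : Finset (V × V)), Set.InjOn φ T → UniquelyCrossed φ T B →
      (2 ≤ T.card → B.card + 2 ≤ T.card) ∧
      (3 ≤ T.card → ∀ g ∈ T, (∀ e ∈ B, e.1 ≠ g ∧ e.2 ≠ g) → B.card + 3 ≤ T.card) := by
  induction T using Finset.strongInduction with
  | H T ih =>
    have hthree : ∀ (φ : V → ℕ) (B : Finset (V × V)), Set.InjOn φ T → UniquelyCrossed φ T B →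
        3 ≤ T.card → ∀ g ∈ T, (∀ e ∈ B, e.1 ≠ g ∧ e.2 ≠ g) → B.card + 3 ≤ T.card := by
      intro φ B hφ h hT g hgT hg
      obtain ⟨M, hM⟩ : ∃ M, ∀ x ∈ T, φ x < M :=
        ⟨T.sup φ + 1, fun x hx => Nat.lt_succ_of_le (Finset.le_sup hx)⟩
      have hinj : Set.InjOn (fun x => if φ x < φ g then φ x + M else φ x) T := by
        intro x hx y hy hxy
        have h1 := hM x hx
        have h2 := hM y hy
        refine hφ hx hy ?_
        simp only at hxy
        split_ifs at hxy <;> omega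
      refine card_add_three_le_of_first hinj
        (fun T' B' hT' hc h' => (ih T' hT' _ B' (hinj.mono hT'.1) h').1 hc)
        (fun T' B' g' hT' hc hg' hav h' => (ih T' hT' _ B' (hinj.mono hT'.1) h').2 hc g' hg' hav)
        (h.rotate g hM) hT hgT (fun x hx => ?_) hg
      have h1 := hM g hgT
      have h2 : φ x ≠ φ g := fun heq => Finset.ne_of_mem_erase hx
        (hφ (Finset.mem_of_mem_erase hx) hgT heq)
      simp only [lt_irrefl, if_false]
      split_ifs <;> omega
    intro φ B hφ h
    refine ⟨fun hT => ?_, hthree φ B hφ h⟩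
    rcases hT.eq_or_lt with hT | hT
    · rw [h.eq_empty hT.ge, Finset.card_empty]
      omega
    · exact h.card_add_two_le_of_avoiding hT fun g hg =>
        hthree φ _ hφ (h.subset (Finset.filter_subset _ _)) hT g hg fun e he =>
          ⟨(Finset.mem_filter.1 he).2.1.symm, (Finset.mem_filter.1 he).2.2.symm⟩

section Polygon

variable {n : ℕ}

theorem bpGraph_adj {B : Finset (Sym2 (ZMod n))} {a b : ZMod n} :
    (bpGraph n B).Adj a b ↔ (s(a, b) ∈ B ∨ IsBoundaryEdge n s(a, b)) ∧ a ≠ b := by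
  rw [bpGraph, SimpleGraph.fromEdgeSet_adj]
  rfl

/-- The edges of `bpGraph n B` inside `s` are braces inside `s` or boundary edges inside `s`. -/
theorem ncard_bpGraph_edges_le (B : Finset (Sym2 (ZMod n))) (s : Finset (ZMod n)) :
    {e ∈ (bpGraph n B).edgeSet | ∀ v ∈ e, v ∈ s}.ncard ≤
      ((B.image Quot.out).filter fun e => e.1 ∈ s ∧ e.2 ∈ s).card +
        (s.filter fun i => i + 1 ∈ s).card := by
  have hsub : {e ∈ (bpGraph n B).edgeSet | ∀ v ∈ e, v ∈ s} ⊆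
      ↑((((B.image Quot.out).filter fun e => e.1 ∈ s ∧ e.2 ∈ s).image fun e => s(e.1, e.2)) ∪
        ((s.filter fun i => i + 1 ∈ s).image fun i => s(i, i + 1))) := by
    rintro e ⟨he, hes⟩
    rw [bpGraph, SimpleGraph.edgeSet_fromEdgeSet] at he
    rw [Finset.mem_coe, Finset.mem_union]
    rcases he.1 with hB | ⟨i, rfl⟩
    · have hout : s((Quot.out e).1, (Quot.out e).2) = e := Quot.out_eq e
      refine Or.inl (Finset.mem_image.2 ⟨Quot.out e, Finset.mem_filter.2
        ⟨Finset.mem_image_of_mem _ hB, hes _ e.out_fst_mem, hes _ e.out_snd_mem⟩, hout⟩)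
    · exact Or.inr (Finset.mem_image.2 ⟨i, Finset.mem_filter.2
        ⟨hes _ (Sym2.mem_mk_left _ _), hes _ (Sym2.mem_mk_right _ _)⟩, rfl⟩)
  refine (Set.ncard_le_ncard hsub (Finset.finite_toSet _)).trans ?_
  rw [Set.ncard_coe_finset]
  exact (Finset.card_union_le _ _).trans (add_le_add Finset.card_image_le Finset.card_image_le)

variable [NeZero n]

theorem ZMod.val_add_one_cases (i : ZMod n) :
    i.val + 1 < n ∧ (i + 1).val = i.val + 1 ∨ i.val + 1 = n ∧ (i + 1).val = 0 := by
  rcases Nat.lt_or_ge (i.val + 1) n with h | h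
  · have h1 : (1 : ZMod n).val = 1 := ZMod.val_one'' (by omega)
    exact Or.inl ⟨h, by rw [ZMod.val_add_of_lt (by omega), h1]⟩
  · have hi := ZMod.val_lt i
    have he : i.val + 1 = n := by omega
    refine Or.inr ⟨he, ?_⟩
    have : i + 1 = 0 := by
      rw [← ZMod.natCast_zmod_val i, ← Nat.cast_one, ← Nat.cast_add, he, ZMod.natCast_self]
    rw [this, ZMod.val_zero]

theorem bpGraph_adj_add_one (hn : 4 ≤ n) (B : Finset (Sym2 (ZMod n))) (i : ZMod n) :
    (bpGraph n B).Adj i (i + 1) := by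
  rw [bpGraph, SimpleGraph.fromEdgeSet_adj]
  refine ⟨Or.inr ⟨i, rfl⟩, fun h => ?_⟩
  have := ZMod.val_add_one_cases i
  rw [← h] at this
  omega

/-- Vertices with no deleted vertex between them are joined in the complement of `s`. -/
theorem bpGraph_reachable_of_interval (hn : 4 ≤ n) (B : Finset (Sym2 (ZMod n)))
    {s : Set (ZMod n)} (k : ℕ) (a b : ↥sᶜ) (hk : a.1.val + k = b.1.val)
    (h : ∀ x ∈ s, ¬ (a.1.val < x.val ∧ x.val < b.1.val)) :
    ((bpGraph n B).induce sᶜ).Reachable a b := by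
  induction k generalizing a with
  | zero =>
    rw [Subtype.ext (ZMod.val_injective n hk)]
  | succ k ih =>
    have hb := ZMod.val_lt b.1
    have hsucc : (a.1 + 1).val = a.1.val + 1 := by
      have := ZMod.val_add_one_cases a.1
      omega
    have hmem : a.1 + 1 ∈ sᶜ := by
      intro hs
      by_cases hk0 : k = 0
      · have : a.1 + 1 = b.1 := ZMod.val_injective n (by omega)
        exact b.2 (this ▸ hs)
      · exact h _ hs (by omega)
    have hadj : ((bpGraph n B).induce sᶜ).Adj a ⟨a.1 + 1, hmem⟩ :=
      bpGraph_adj_add_one hn B a.1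
    exact hadj.reachable.trans (ih ⟨a.1 + 1, hmem⟩ (by simp only; omega) fun x hx hx' =>
      h x hx (by simp only at hx'; omega))

/-- Vertices with all deleted vertices between them are joined in the complement of `s`. -/
theorem bpGraph_reachable_of_outside (hn : 4 ≤ n) (B : Finset (Sym2 (ZMod n)))
    {s : Set (ZMod n)} (a b : ↥sᶜ)
    (h : ∀ x ∈ s, a.1.val < x.val ∧ x.val < b.1.val) :
    ((bpGraph n B).induce sᶜ).Reachable a b := by
  have hn1 : ((n - 1 : ℕ) : ZMod n).val = n - 1 := ZMod.val_cast_of_lt (by omega)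
  have h0 : (0 : ZMod n) ∈ sᶜ := fun hs => by
    have := h _ hs
    rw [ZMod.val_zero] at this
    omega
  have hl : ((n - 1 : ℕ) : ZMod n) ∈ sᶜ := fun hs => by
    have := h _ hs
    have := ZMod.val_lt b.1
    omega
  have hb := ZMod.val_lt b.1
  have r1 := bpGraph_reachable_of_interval hn B a.1.val ⟨0, h0⟩ a (by simp) fun x hx => by
    have := h x hx
    omega
  have r2 := bpGraph_reachable_of_interval hn B (n - 1 - b.1.val) b ⟨_, hl⟩
    (by simp only [hn1]; omega) fun x hx => by
    have := h x hx
    omega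
  have hadj : ((bpGraph n B).induce sᶜ).Adj ⟨_, hl⟩ ⟨0, h0⟩ := by
    have h1 := bpGraph_adj_add_one hn B ((n - 1 : ℕ) : ZMod n)
    have h2 : ((n - 1 : ℕ) : ZMod n) + 1 = 0 := by
      rw [← Nat.cast_succ, Nat.succ_eq_add_one, Nat.sub_add_cancel (by omega), ZMod.natCast_self]
    rwa [h2] at h1
  exact ((r2.trans hadj.reachable).trans r1).symm

/-- Vertices on the same side of the chord `{x, y}` are joined outside `{x, y}`. -/
theorem bpGraph_reachable_of_same_side (hn : 4 ≤ n) (B : Finset (Sym2 (ZMod n)))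
    {s : Set (ZMod n)} {x y : ZMod n} (hs : s = {x, y}) (a b : ↥sᶜ)
    (h : StrictlyInside x.val y.val a.1.val ↔ StrictlyInside x.val y.val b.1.val) :
    ((bpGraph n B).induce sᶜ).Reachable a b := by
  wlog hab : a.1.val ≤ b.1.val generalizing a b
  · exact (this b a h.symm (by omega)).symm
  have hne : ∀ c : ↥sᶜ, c.1.val ≠ x.val ∧ c.1.val ≠ y.val := fun c => by
    constructor <;> intro hc <;> refine c.2 ?_ <;> rw [ZMod.val_injective n hc, hs] <;> simp
  have ha := hne a
  have hb := hne b
  have hall : ∀ P : ZMod n → Prop, P x → P y → ∀ z ∈ s, P z := by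
    intro P hx hy z hz
    rw [hs] at hz
    rcases hz with rfl | rfl
    · exact hx
    · exact hy
  by_cases hx : a.1.val < x.val ∧ x.val < b.1.val
  · refine bpGraph_reachable_of_outside hn B a b (hall _ hx ?_)
    unfold StrictlyInside at h
    omega
  · refine bpGraph_reachable_of_interval hn B (b.1.val - a.1.val) a b (by omega) (hall _ hx ?_)
    unfold StrictlyInside at h
    omega

theorem chordsCross_iff_of_ne {x y a b : ℕ} (hax : a ≠ x) (hay : a ≠ y) (hbx : b ≠ x)
    (hby : b ≠ y) :
    ChordsCross a b x y ↔ ¬ (StrictlyInside x y a ↔ StrictlyInside x y b) := by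
  unfold ChordsCross StrictlyInside StrictlyOutside
  omega

/-- If every chord crossed by the brace `{u, v}` is crossed by another brace, then deleting
`{u, v}` preserves 3-connectivity. -/
theorem threeConnected_erase (hn : 4 ≤ n) {B : Finset (Sym2 (ZMod n))}
    (h3 : ThreeConnected (bpGraph n B)) (u v : ZMod n)
    (h : ∀ x y : ZMod n, ChordsCross u.val v.val x.val y.val →
      ∃ p q : ZMod n, s(p, q) ∈ B ∧ s(p, q) ≠ s(u, v) ∧
        ChordsCross p.val q.val x.val y.val) :
    ThreeConnected (bpGraph n (B.erase s(u, v))) := by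
  refine ⟨h3.1, fun s hs => ?_⟩
  set S : Set (ZMod n) := (s : Set (ZMod n)) with hS
  have hconn := h3.2 s hs
  have huv : ∀ a b : ↥Sᶜ, a.1 = u → b.1 = v →
      ((bpGraph n (B.erase s(u, v))).induce Sᶜ).Reachable a b := by
    intro a b hau hbv
    by_cases hemp : s = ∅
    · have hno : ∀ x ∈ S, False := fun x hx => by
        rw [hS, hemp] at hx
        simp at hx
      rcases le_total a.1.val b.1.val with hab | hab
      · exact bpGraph_reachable_of_interval hn _ (b.1.val - a.1.val) a b (by omega)
          fun x hx => (hno x hx).elim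
      · exact (bpGraph_reachable_of_interval hn _ (a.1.val - b.1.val) b a (by omega)
          fun x hx => (hno x hx).elim).symm
    obtain ⟨x, y, hxy⟩ : ∃ x y, S = {x, y} := by
      have hpos : s.card ≠ 0 := fun h0 => hemp (Finset.card_eq_zero.1 h0)
      obtain h1 | h2 : s.card = 1 ∨ s.card = 2 := by omega
      · obtain ⟨x, rfl⟩ := Finset.card_eq_one.1 h1
        exact ⟨x, x, by simp [hS]⟩
      · obtain ⟨x, y, -, rfl⟩ := Finset.card_eq_two.1 h2
        exact ⟨x, y, by simp [hS]⟩
    have hne : ∀ c : ↥Sᶜ, c.1.val ≠ x.val ∧ c.1.val ≠ y.val := fun c => by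
      constructor <;> intro hc <;> refine c.2 ?_ <;> rw [ZMod.val_injective n hc, hxy] <;> simp
    by_cases hside : StrictlyInside x.val y.val a.1.val ↔ StrictlyInside x.val y.val b.1.val
    · exact bpGraph_reachable_of_same_side hn _ hxy a b hside
    obtain ⟨p, q, hpq, hpqne, hcr⟩ := h x y (by
      rw [← hau, ← hbv]
      exact (chordsCross_iff_of_ne (hne a).1 (hne a).2 (hne b).1 (hne b).2).2 hside)
    have hpne : (p.val ≠ x.val ∧ p.val ≠ y.val) ∧ (q.val ≠ x.val ∧ q.val ≠ y.val) ∧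
        p.val ≠ q.val := by
      unfold ChordsCross StrictlyInside StrictlyOutside at hcr
      omega
    have hmem : ∀ c : ZMod n, c.val ≠ x.val ∧ c.val ≠ y.val → c ∈ Sᶜ := by
      rintro c ⟨h1, h2⟩ hc
      rw [hxy] at hc
      rcases hc with rfl | rfl
      · exact h1 rfl
      · exact h2 rfl
    have hp := hmem p hpne.1
    have hq := hmem q hpne.2.1
    have hadj : ((bpGraph n (B.erase s(u, v))).induce Sᶜ).Adj ⟨p, hp⟩ ⟨q, hq⟩ :=
      bpGraph_adj.2 ⟨Or.inl (Finset.mem_erase.2 ⟨hpqne, hpq⟩),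
        fun h => hpne.2.2 (congrArg ZMod.val h)⟩
    have hpqside := (chordsCross_iff_of_ne hpne.1.1 hpne.1.2 hpne.2.1.1 hpne.2.1.2).1 hcr
    have hopp : ∀ {P Q R S : Prop}, ¬ (P ↔ Q) → ¬ (R ↔ S) → (P ↔ R) → (S ↔ Q) := by tauto
    by_cases hap : StrictlyInside x.val y.val a.1.val ↔ StrictlyInside x.val y.val p.val
    · exact ((bpGraph_reachable_of_same_side hn _ hxy a ⟨p, hp⟩ hap).trans
        hadj.reachable).trans (bpGraph_reachable_of_same_side hn _ hxy ⟨q, hq⟩ b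
          (hopp hside hpqside hap))
    · exact ((bpGraph_reachable_of_same_side hn _ hxy a ⟨q, hq⟩
        (hopp hpqside (fun h => hap h.symm) Iff.rfl)).trans
        hadj.symm.reachable).trans
          (bpGraph_reachable_of_same_side hn _ hxy ⟨p, hp⟩ b
            (hopp hside hap Iff.rfl))
  have := hconn.nonempty
  refine ⟨fun a b => ?_⟩
  obtain ⟨w⟩ := hconn.preconnected a b
  induction w with
  | nil => exact SimpleGraph.Reachable.refl _
  | @cons a c b hac _ ih =>
    refine SimpleGraph.Reachable.trans ?_ ih
    obtain ⟨hB, hne⟩ := bpGraph_adj.1 (SimpleGraph.comap_adj.1 hac)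
    by_cases he : s(a.1, c.1) = s(u, v)
    · rcases Sym2.eq_iff.1 he with ⟨h1, h2⟩ | ⟨h1, h2⟩
      · exact huv a c h1 h2
      · exact (huv c a h2 h1).symm
    · refine SimpleGraph.Adj.reachable (SimpleGraph.comap_adj.2 (bpGraph_adj.2 ⟨?_, hne⟩))
      exact hB.imp_left fun h => Finset.mem_erase.2 ⟨he, h⟩

/-- A minimally 3-connected family of braces is uniquely crossed. -/
theorem MinThreeConnectedBP.uniquelyCrossed (hn : 4 ≤ n) {B : Finset (Sym2 (ZMod n))}
    (h : MinThreeConnectedBP n B) :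
    UniquelyCrossed ZMod.val (Finset.univ : Finset (ZMod n)) (B.image Quot.out) := by
  refine ⟨fun _ _ => by simp, fun e he => ?_⟩
  obtain ⟨e', he', rfl⟩ := Finset.mem_image.1 he
  have hout : ∀ z : Sym2 (ZMod n), s((Quot.out z).1, (Quot.out z).2) = z := fun z => Quot.out_eq z
  by_contra! hcon
  refine h.2 e' he' ?_
  rw [← hout e']
  refine threeConnected_erase hn h.1 _ _ fun x y hxy => ?_
  obtain ⟨f, hf, hfx, hfne⟩ := hcon x (Finset.mem_univ _) y (Finset.mem_univ _) hxy
  obtain ⟨f', hf', rfl⟩ := Finset.mem_image.1 hf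
  refine ⟨_, _, (hout f').symm ▸ hf', fun heq => hfne ?_, hfx⟩
  rw [hout, hout] at heq
  rw [heq]

/-- The vertices of `s` together with one vertex from each gap of `s`. -/
def withGaps (s : Finset (ZMod n)) : Finset (ZMod n) :=
  s ∪ (s.filter fun i => i + 1 ∉ s).image (· + 1)

/-- Every vertex can be replaced by one in `withGaps s`, without changing its position relative to
chords of `s`. -/
theorem exists_mem_withGaps {s : Finset (ZMod n)} (hs : s.Nonempty) (c : ZMod n) :
    ∃ t ∈ withGaps s, ∀ a ∈ s, ∀ b ∈ s,
      (StrictlyInside a.val b.val t.val ↔ StrictlyInside a.val b.val c.val) ∧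
      (StrictlyOutside a.val b.val t.val ↔ StrictlyOutside a.val b.val c.val) := by
  by_cases hc : c ∈ s
  · exact ⟨c, Finset.mem_union_left _ hc, fun _ _ _ _ => ⟨Iff.rfl, Iff.rfl⟩⟩
  obtain ⟨i, hi⟩ := hs
  have key : ∀ k : ℕ, i + (k : ZMod n) ∉ s → ∃ t ∈ withGaps s, ∀ a ∈ s, ∀ b ∈ s,
      (StrictlyInside a.val b.val t.val ↔ StrictlyInside a.val b.val (i + (k : ZMod n)).val) ∧
      (StrictlyOutside a.val b.val t.val ↔ StrictlyOutside a.val b.val (i + (k : ZMod n)).val) := by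
    intro k
    induction k with
    | zero => intro h; simp [hi] at h
    | succ k ih =>
      intro h
      rw [Nat.cast_succ, ← add_assoc] at h ⊢
      by_cases hk : i + (k : ZMod n) ∈ s
      · exact ⟨i + (k : ZMod n) + 1, Finset.mem_union_right _ (Finset.mem_image_of_mem _
          (Finset.mem_filter.2 ⟨hk, h⟩)), fun _ _ _ _ => ⟨Iff.rfl, Iff.rfl⟩⟩
      · obtain ⟨t, ht, hab⟩ := ih hk
        refine ⟨t, ht, fun a ha b hb => ?_⟩
        obtain ⟨h1, h2⟩ := hab a ha b hb
        rw [h1, h2]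
        have hne : ∀ x ∈ s, x.val ≠ (i + (k : ZMod n)).val ∧
            x.val ≠ (i + (k : ZMod n) + 1).val := fun x hx =>
          ⟨fun he => hk (ZMod.val_injective n he ▸ hx), fun he => h (ZMod.val_injective n he ▸ hx)⟩
        have := hne a ha
        have := hne b hb
        have := ZMod.val_lt a
        have := ZMod.val_lt b
        have := ZMod.val_add_one_cases (i + (k : ZMod n))
        unfold StrictlyInside StrictlyOutside
        omega
  have hck : i + (((c - i).val : ℕ) : ZMod n) = c := by
    rw [ZMod.natCast_zmod_val]
    ring
  have := key (c - i).val
  rw [hck] at this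
  exact this hc

theorem UniquelyCrossed.withGaps {B : Finset (ZMod n × ZMod n)}
    (h : UniquelyCrossed ZMod.val Finset.univ B) {s : Finset (ZMod n)} (hs : s.Nonempty) :
    UniquelyCrossed ZMod.val (withGaps s) (B.filter fun e => e.1 ∈ s ∧ e.2 ∈ s) := by
  refine ⟨fun e he => ?_, fun e he => ?_⟩
  · obtain ⟨-, h1, h2⟩ := Finset.mem_filter.1 he
    exact ⟨Finset.mem_union_left _ h1, Finset.mem_union_left _ h2⟩
  · obtain ⟨heB, he1, he2⟩ := Finset.mem_filter.1 he
    obtain ⟨c, -, d, -, hx, hf⟩ := h.witness e heB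
    obtain ⟨c', hc', hcc⟩ := exists_mem_withGaps hs c
    obtain ⟨d', hd', hdd⟩ := exists_mem_withGaps hs d
    have key : ∀ a ∈ s, ∀ b ∈ s, ChordsCross a.val b.val c'.val d'.val ↔
        ChordsCross a.val b.val c.val d.val := fun a ha b hb => by
      unfold ChordsCross
      rw [(hcc a ha b hb).1, (hcc a ha b hb).2, (hdd a ha b hb).1, (hdd a ha b hb).2]
    refine ⟨c', hc', d', hd', (key _ he1 _ he2).2 hx, fun f hfB hfx => ?_⟩
    obtain ⟨hfB, hf1, hf2⟩ := Finset.mem_filter.1 hfB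
    exact hf f hfB ((key _ hf1 _ hf2).1 hfx)

theorem exists_mem_add_one_notMem {s : Finset (ZMod n)} (hs : s.Nonempty) (hsn : s.card < n) :
    ∃ i ∈ s, i + 1 ∉ s := by
  by_contra! hcon
  obtain ⟨i, hi⟩ := hs
  have key : ∀ k : ℕ, i + (k : ZMod n) ∈ s := by
    intro k
    induction k with
    | zero => simpa using hi
    | succ k ih =>
      rw [Nat.cast_succ, ← add_assoc]
      exact hcon _ ih
  have huniv : s = Finset.univ := Finset.eq_univ_of_forall fun c => by
    have := key (c - i).val
    rwa [ZMod.natCast_zmod_val, add_sub_cancel] at this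
  rw [huniv, Finset.card_univ, ZMod.card] at hsn
  exact lt_irrefl _ hsn

end Polygon

/-- If `G` is a minimally 3-connected braced polygon graph on `n`
vertices with `m ≥ 2n - 2` edges, then `m = 2n - 2` and `G` is a generic rigidity
circuit: every subgraph on `k` vertices (`2 ≤ k < n`) has at most `2k - 3` edges. -/
theorem stmt13 (n : ℕ) [NeZero n] (hn : 4 ≤ n) (B : Finset (Sym2 (ZMod n)))
    (hB : ∀ e ∈ B, ¬ e.IsDiag ∧ ¬ IsBoundaryEdge n e)
    (hmin : MinThreeConnectedBP n B)
    (hm : 2 * n - 2 ≤ (bpGraph n B).edgeSet.ncard) :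
    (bpGraph n B).edgeSet.ncard = 2 * n - 2 ∧
      ∀ s : Finset (ZMod n), 2 ≤ s.card → s.card < n →
        {e ∈ (bpGraph n B).edgeSet | ∀ v ∈ e, v ∈ s}.ncard ≤ 2 * s.card - 3 := by
  have hinj : ∀ T : Finset (ZMod n), Set.InjOn ZMod.val (T : Set (ZMod n)) := fun _ =>
    (ZMod.val_injective n).injOn
  have hcross := hmin.uniquelyCrossed hn
  refine ⟨le_antisymm ?_ hm, fun s hs hsn => ?_⟩
  · have h1 := ncard_bpGraph_edges_le B Finset.univ
    have h2 := (UniquelyCrossed.card_bounds _ _ _ (hinj _) hcross).1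
    simp only [Finset.mem_univ, implies_true, and_true, Set.ofPred_mem_eq, and_self,
      Finset.filter_true, Finset.card_univ, ZMod.card] at h1 h2
    have := h2 (by omega)
    omega
  · have hsne : s.Nonempty := Finset.card_pos.1 (by omega)
    obtain ⟨i, hi, hi'⟩ := exists_mem_add_one_notMem hsne hsn
    have hmem : i + 1 ∈ withGaps s := Finset.mem_union_right _
      (Finset.mem_image_of_mem _ (Finset.mem_filter.2 ⟨hi, hi'⟩))
    have hlt : s.card < (withGaps s).card := Finset.card_lt_card
      ⟨Finset.subset_union_left, fun h => hi' (h hmem)⟩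
    have h1 := ncard_bpGraph_edges_le B s
    have h2 := (UniquelyCrossed.card_bounds _ _ _ (hinj _) (hcross.withGaps hsne)).2 (by omega)
      (i + 1) hmem fun e he => by
        obtain ⟨-, h1, h2⟩ := Finset.mem_filter.1 he
        exact ⟨fun h => hi' (h ▸ h1), fun h => hi' (h ▸ h2)⟩
    have h3 : (withGaps s).card ≤ s.card + (s.filter fun i => i + 1 ∉ s).card :=
      (Finset.card_union_le _ _).trans (Nat.add_le_add_left Finset.card_image_le _)
    have h4 := Finset.card_filter_add_card_filter_not (s := s) fun i => i + 1 ∈ s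
    omega
end
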